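/- arXiv:2202.01369 — 4 statements merged into one kernel-verified Lean document; each statement's English description precedes it below -/
import Mathlib

section
/- Let q be a prime power with q ≡ 3 (mod 4) and set v = 1 + q + q² + q³. Then there exists a v×v integer matrix W with entries in {−1,0,1} such that W·Wᵀ = (q+q²)·I and |W| is the adjacency matrix of a strongly regular graph SRG(v, q+q², q−1, q+1). -/
open Matrix

/-- The all-ones matrix. -/
def allOnes (ι : Type*) : Matrix ι ι ℤ := Matrix.of fun _ _ => 1

/-- `A` is the adjacency matrix of a strongly regular graph with parameters `(v, k, l, mu)`:
`A` is a symmetric `(0,1)`-matrix with zero diagonal satisfying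
`A² = k·I + l·A + mu·(J - I - A)`. -/
def IsSRGAdj {ι : Type*} [Fintype ι] [DecidableEq ι]
    (A : Matrix ι ι ℤ) (k l mu : ℤ) : Prop :=
  A.IsSymm ∧ (∀ i, A i i = 0) ∧ (∀ i j, A i j = 0 ∨ A i j = 1) ∧
    A * A = k • (1 : Matrix ι ι ℤ) + l • A + mu • (allOnes ι - 1 - A)

namespace QuadraticPlane

open QuadraticAlgebra Finset

variable {F : Type*} [Field F] {a b : F}

instance [Fintype F] : Fintype (QuadraticAlgebra F a b) :=
  Fintype.ofEquiv _ (equivProd a b).symm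

/-- The determinant of two vectors of the plane over the quadratic extension. -/
def det (u z : QuadraticAlgebra F a b × QuadraticAlgebra F a b) : QuadraticAlgebra F a b :=
  u.1 * z.2 - u.2 * z.1

lemma det_swap (u z : QuadraticAlgebra F a b × QuadraticAlgebra F a b) :
    det z u = -det u z := by
  simp only [det]; ring

/-- A character of the base field, applied to the elements of the quadratic extension that lie in
the base field, and extended by zero. -/
def extChar [DecidableEq F] (ψ : MulChar F ℤ) (x : QuadraticAlgebra F a b) : ℤ :=
  if x.im = 0 then ψ x.re else 0

section

variable [DecidableEq F] (ψ : MulChar F ℤ)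

@[simp]
lemma extChar_zero : extChar ψ (0 : QuadraticAlgebra F a b) = 0 := by
  simp [extChar, ψ.map_zero]

lemma extChar_smul (r : F) (x : QuadraticAlgebra F a b) :
    extChar ψ (r • x) = ψ r * extChar ψ x := by
  by_cases hr : r = 0
  · simp [hr, ψ.map_zero]
  · simp [extChar, hr]

lemma extChar_mul_extChar_mul {x c : QuadraticAlgebra F a b} (hc : c.im ≠ 0) :
    extChar ψ x * extChar ψ (x * c) = 0 := by
  by_cases hx : x.im = 0
  · by_cases hr : x.re = 0
    · simp [extChar, hr, ψ.map_zero]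
    · simp [extChar, hx, hr, hc]
  · simp [extChar, hx]

lemma sum_extChar_mul [Fintype F] (h : QuadraticAlgebra F a b → ℤ) :
    ∑ x, extChar ψ x * h x = ∑ r, ψ r * h (r • 1) := by
  rw [← (equivProd a b).symm.sum_comp, Fintype.sum_prod_type]
  refine sum_congr rfl fun r _ ↦ ?_
  rw [Fintype.sum_eq_single 0]
  · have : (⟨r, 0⟩ : QuadraticAlgebra F a b) = r • 1 := by ext <;> simp
    simp [extChar, ← this]
  · intro s hs
    simp [extChar, hs]

lemma sum_extChar [Fintype F] : ∑ x : QuadraticAlgebra F a b, extChar ψ x = ∑ r, ψ r := by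
  simpa [extChar] using sum_extChar_mul (a := a) (b := b) ψ 1

omit [Field F] [DecidableEq F] in
lemma sum_apply_im [Fintype F] (h : F → ℤ) :
    ∑ x : QuadraticAlgebra F a b, h x.im = Fintype.card F * ∑ r, h r := by
  rw [← (equivProd a b).symm.sum_comp, Fintype.sum_prod_type]
  simp

end

variable [Fact (∀ r, r ^ 2 ≠ a + b * r)]

lemma im_inv_eq_zero {x : QuadraticAlgebra F a b} : x⁻¹.im = 0 ↔ x.im = 0 := by
  by_cases hx : x = 0
  · simp [hx]
  · have : norm x ≠ 0 := fun h ↦ hx (norm_eq_zero_iff_eq_zero.1 h)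
    simp [QuadraticAlgebra.inv_def, this]

omit [Fact (∀ r, r ^ 2 ≠ a + b * r)] in
lemma sum_im_mul_im_mul [Fintype F] {c : QuadraticAlgebra F a b} (hc : c.im ≠ 0) (f g : F → ℤ) :
    ∑ x : QuadraticAlgebra F a b, f x.im * g (x * c).im = (∑ r, f r) * ∑ r, g r := by
  have hinj : Function.Injective
      fun x : QuadraticAlgebra F a b ↦ (x.im, (x * c).im) := by
    intro x y hxy
    simp only [Prod.mk.injEq, im_mul] at hxy
    obtain ⟨h1, h2⟩ := hxy
    rw [h1] at h2
    have : x.re * c.im = y.re * c.im := by linear_combination h2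
    exact QuadraticAlgebra.ext (mul_right_cancel₀ hc this) h1
  have hbij := (Fintype.bijective_iff_injective_and_card _).2
    ⟨hinj, Fintype.card_congr (equivProd a b)⟩
  rw [Fintype.sum_mul_sum, ← Fintype.sum_prod_type']
  exact hbij.sum_comp fun p : F × F ↦ f p.1 * g p.2

/-- The scalar carrying `u` to `z` when the two vectors are proportional and `u ≠ 0`. -/
def ratio [DecidableEq F] (u z : QuadraticAlgebra F a b × QuadraticAlgebra F a b) :
    QuadraticAlgebra F a b :=
  if u.1 = 0 then z.2 / u.2 else z.1 / u.1

variable [DecidableEq F] (ψ : MulChar F ℤ)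

/-- The weight attached to two vectors: a character value of the imaginary part of their ratio
if they are proportional, and of their determinant otherwise. -/
def weight (u z : QuadraticAlgebra F a b × QuadraticAlgebra F a b) : ℤ :=
  if det u z = 0 then ψ (ratio u z).im else extChar ψ (det u z)

variable {u v : QuadraticAlgebra F a b × QuadraticAlgebra F a b}

lemma ratio_smul_self (hu : u ≠ 0) (x : QuadraticAlgebra F a b) : ratio u (x • u) = x := by
  by_cases h : u.1 = 0
  · have h2 : u.2 ≠ 0 := fun h2 ↦ hu (Prod.ext h h2)
    simp [ratio, h, h2]
  · simp [ratio, h]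

lemma weight_smul_self (hu : u ≠ 0) (x : QuadraticAlgebra F a b) :
    weight ψ u (x • u) = ψ x.im := by
  have : det u (x • u) = 0 := by simp [det]; ring
  rw [weight, if_pos this, ratio_smul_self hu]

lemma weight_combination (hd : det u v ≠ 0) (x y : QuadraticAlgebra F a b) :
    weight ψ u (x • u + y • v) =
      extChar ψ (y * det u v) + if y = 0 then ψ x.im else 0 := by
  have hu : u ≠ 0 := by rintro rfl; simp [det] at hd
  by_cases hy : y = 0
  · simp [hy, weight_smul_self ψ hu]
  · have h : det u (x • u + y • v) = y * det u v := by simp [det]; ring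
    rw [weight, h, if_neg (mul_ne_zero hy hd), if_neg hy, add_zero]

lemma weight_zero_right (hu : u ≠ 0) : weight ψ u 0 = 0 := by
  simpa [ψ.map_zero] using weight_smul_self ψ hu 0

lemma weight_smul_right (r : F) (hu : u ≠ 0) : weight ψ u (r • v) = ψ r * weight ψ u v := by
  by_cases hr : r = 0
  · simp [hr, weight_zero_right ψ hu, ψ.map_zero]
  have h : det u (r • v) = r • det u v := by ext <;> simp [det] <;> ring
  have h' : ratio u (r • v) = r • ratio u v := by
    by_cases h : u.1 = 0 <;> simp [ratio, h, div_eq_mul_inv]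
  simp only [weight, h, h', extChar_smul, smul_eq_zero, hr, false_or]
  split_ifs <;> simp

omit [DecidableEq F] in
lemma combination_bijective (hd : det u v ≠ 0) :
    Function.Bijective fun p : QuadraticAlgebra F a b × QuadraticAlgebra F a b ↦
      p.1 • u + p.2 • v := by
  simp only [det] at hd
  constructor
  · rintro ⟨x, y⟩ ⟨x', y'⟩ h
    simp only [Prod.ext_iff, Prod.fst_add, Prod.snd_add, Prod.smul_fst, Prod.smul_snd,
      smul_eq_mul] at h ⊢
    obtain ⟨h1, h2⟩ := h
    constructor
    · apply mul_right_cancel₀ hd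
      linear_combination v.2 * h1 - v.1 * h2
    · apply mul_right_cancel₀ hd
      linear_combination u.1 * h2 - u.2 * h1
  · rintro ⟨z, w⟩
    refine ⟨((z * v.2 - w * v.1) / (u.1 * v.2 - u.2 * v.1),
      (u.1 * w - u.2 * z) / (u.1 * v.2 - u.2 * v.1)), ?_⟩
    ext1 <;>
    · simp only [Prod.fst_add, Prod.snd_add, Prod.smul_fst, Prod.smul_snd, smul_eq_mul]
      rw [div_mul_eq_mul_div, div_mul_eq_mul_div, ← add_div, div_eq_iff hd]
      ring

lemma exists_det_eq_one (hu : u ≠ 0) : ∃ v, det u v = 1 := by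
  by_cases h : u.1 = 0
  · have h2 : u.2 ≠ 0 := fun h2 ↦ hu (Prod.ext h h2)
    exact ⟨(-u.2⁻¹, 0), by simp [det, h2]⟩
  · exact ⟨(0, u.1⁻¹), by simp [det, h]⟩

lemma exists_eq_smul_of_det_eq_zero (hu : u ≠ 0) (h : det u v = 0) :
    ∃ c : QuadraticAlgebra F a b, v = c • u := by
  refine ⟨ratio u v, ?_⟩
  simp only [det] at h
  by_cases h1 : u.1 = 0
  · have h2 : u.2 ≠ 0 := fun h2 ↦ hu (Prod.ext h1 h2)
    have h3 : v.1 = 0 := by simpa [h1, h2] using h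
    ext1 <;> simp [ratio, h1, h2, h3]
  · ext1
    · simp [ratio, h1]
    · simp only [ratio, h1, if_false, Prod.smul_snd, smul_eq_mul]
      field_simp
      linear_combination h

variable [Fintype F]

lemma sum_weight_mul_weight_of_det_ne_zero (hd : det u v ≠ 0) :
    ∑ z, weight ψ u z * weight ψ v z =
      (∑ r, ψ r) ^ 2 + (1 + ψ (-1)) * ψ (det u v)⁻¹.im * ∑ r, ψ r ^ 2 := by
  set d := det u v with hd'
  have hd2 : det v u = -d := det_swap u v
  have hdv : det v u ≠ 0 := by rw [hd2]; exact neg_ne_zero.2 hd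
  rw [← (combination_bijective hd).sum_comp, Fintype.sum_prod_type]
  have key (x y : QuadraticAlgebra F a b) :
      weight ψ u (x • u + y • v) * weight ψ v (x • u + y • v) =
        extChar ψ (x * -d) * extChar ψ (y * d) +
        (if x = 0 then extChar ψ (y * d) * ψ y.im else 0) +
        (if y = 0 then extChar ψ (x * -d) * ψ x.im else 0) := by
    rw [weight_combination ψ hd, add_comm (x • u), weight_combination ψ hdv, hd2, ← hd']
    by_cases hx : x = 0 <;> by_cases hy : y = 0 <;> simp [hx, hy, ψ.map_zero, mul_comm]
  simp only [key, sum_add_distrib, ← sum_mul_sum]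
  have e1 {c : QuadraticAlgebra F a b} (hc : c ≠ 0) :
      ∑ x, extChar ψ (x * c) = ∑ r, ψ r := by
    rw [← sum_extChar (a := a) (b := b)]
    exact Equiv.sum_comp (Equiv.mulRight₀ c hc) fun x ↦ extChar ψ x
  have e2 {c : QuadraticAlgebra F a b} (hc : c ≠ 0) :
      ∑ x, extChar ψ (x * c) * ψ x.im = ψ c⁻¹.im * ∑ r, ψ r ^ 2 := by
    have h := Equiv.sum_comp (Equiv.mulRight₀ c hc) fun x ↦ extChar ψ x * ψ (x * c⁻¹).im
    simp only [Equiv.mulRight₀_apply, mul_inv_cancel_right₀ hc] at h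
    rw [h, sum_extChar_mul, mul_sum]
    refine sum_congr rfl fun r _ ↦ ?_
    simp only [smul_mul_assoc, one_mul, im_smul, smul_eq_mul, map_mul]
    ring
  have e3 : ψ (-d)⁻¹.im = ψ (-1) * ψ d⁻¹.im := by
    rw [← map_mul, inv_neg]; simp
  rw [e1 hd, e1 (neg_ne_zero.2 hd), sum_comm]
  simp only [sum_ite_eq', mem_univ, if_true, e2 hd, e2 (neg_ne_zero.2 hd), e3]
  ring

lemma sum_weight_mul_weight_smul (hu : u ≠ 0) {c : QuadraticAlgebra F a b} (hc : c.im ≠ 0) :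
    ∑ z, weight ψ u z * weight ψ (c • u) z = (∑ r, ψ r) ^ 2 := by
  obtain ⟨v, hd⟩ := exists_det_eq_one hu
  have hd0 : det u v ≠ 0 := by rw [hd]; exact one_ne_zero
  have hc0 : c ≠ 0 := by rintro rfl; simp at hc
  have hdc : det (c • u) v = c := by
    simp only [det, Prod.smul_fst, Prod.smul_snd, smul_eq_mul] at hd ⊢
    linear_combination c * hd
  have hdc0 : det (c • u) v ≠ 0 := by rwa [hdc]
  rw [← (combination_bijective hd0).sum_comp, Fintype.sum_prod_type]
  have key (x y : QuadraticAlgebra F a b) :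
      weight ψ u (x • u + y • v) * weight ψ (c • u) (x • u + y • v) =
        if y = 0 then ψ x.im * ψ (x * c⁻¹).im else 0 := by
    have hx : x • u = (x * c⁻¹) • c • u := by rw [smul_smul, inv_mul_cancel_right₀ hc0]
    rw [weight_combination ψ hd0, hx, weight_combination ψ hdc0, hd, hdc]
    by_cases hy : y = 0
    · simp [hy]
    · simp [hy, extChar_mul_extChar_mul ψ hc]
  simp only [key, sum_ite_eq', mem_univ, if_true]
  rw [sum_im_mul_im_mul (im_inv_eq_zero.not.2 hc), sq]

lemma sum_weight_sq (hu : u ≠ 0) :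
    ∑ z, weight ψ u z * weight ψ u z =
      (Fintype.card F + (Fintype.card F : ℤ) ^ 2) * ∑ r, ψ r ^ 2 := by
  obtain ⟨v, hd⟩ := exists_det_eq_one hu
  have hd0 : det u v ≠ 0 := by rw [hd]; exact one_ne_zero
  rw [← (combination_bijective hd0).sum_comp, Fintype.sum_prod_type]
  have key (x y : QuadraticAlgebra F a b) :
      weight ψ u (x • u + y • v) * weight ψ u (x • u + y • v) =
        extChar ψ y * extChar ψ y + if y = 0 then ψ x.im ^ 2 else 0 := by
    rw [weight_combination ψ hd0, hd]
    by_cases hy : y = 0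
    · simp [hy, sq]
    · simp [hy]
  have h1 := sum_extChar_mul (a := a) (b := b) ψ (extChar ψ)
  simp only [extChar_smul] at h1
  simp only [key, sum_add_distrib, sum_ite_eq', mem_univ, if_true, h1]
  have h2 : Fintype.card (QuadraticAlgebra F a b) = Fintype.card F ^ 2 := by
    rw [Fintype.card_congr (equivProd a b), Fintype.card_prod, sq]
  rw [sum_apply_im fun r ↦ ψ r ^ 2]
  simp [h2, extChar, sq]
  ring

omit [Fintype F] in
lemma det_ne_zero_or_exists_smul (hu : u ≠ 0) (huv : ∀ r : F, v ≠ r • u) :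
    det u v ≠ 0 ∨ ∃ c : QuadraticAlgebra F a b, c.im ≠ 0 ∧ v = c • u := by
  refine or_iff_not_imp_left.2 fun h ↦ ?_
  obtain ⟨c, rfl⟩ := exists_eq_smul_of_det_eq_zero hu (not_not.1 h)
  refine ⟨c, fun hc ↦ huv c.re ?_, rfl⟩
  have : c = c.re • 1 := by ext <;> simp [hc]
  rw [this, smul_assoc, one_smul]
  simp

lemma sum_one_mulChar : ∑ r : F, (1 : MulChar F ℤ) r = (Fintype.card F : ℤ) - 1 := by
  rw [MulChar.sum_one_eq_card_units, Fintype.card_units, Nat.cast_pred Fintype.card_pos]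

omit [Fintype F] in
lemma weight_one_comm (hu : u ≠ 0) (hv : v ≠ 0) :
    weight (1 : MulChar F ℤ) u v = weight 1 v u := by
  by_cases h : det u v = 0
  · obtain ⟨c, rfl⟩ := exists_eq_smul_of_det_eq_zero hu h
    have hc : c ≠ 0 := by rintro rfl; simp at hv
    have hcu : u = c⁻¹ • c • u := by rw [inv_smul_smul₀ hc]
    rw [weight_smul_self _ hu]
    conv_rhs => rw [hcu, smul_inv_smul₀ hc]
    rw [weight_smul_self _ hv]
    by_cases h0 : c.im = 0
    · rw [h0, im_inv_eq_zero.2 h0]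
    · rw [MulChar.one_apply (Ne.isUnit h0),
        MulChar.one_apply (Ne.isUnit (im_inv_eq_zero.not.2 h0))]
  · have h' : det v u ≠ 0 := by rw [det_swap u v]; exact neg_ne_zero.2 h
    rw [weight, weight, if_neg h, if_neg h', det_swap u v, ← neg_one_smul F, extChar_smul,
      MulChar.one_apply (isUnit_one.neg), one_mul]

omit [Fintype F] in
lemma weight_one_self (hu : u ≠ 0) : weight (1 : MulChar F ℤ) u u = 0 := by
  have := weight_smul_self (1 : MulChar F ℤ) hu 1
  rw [one_smul] at this
  simp [this, MulChar.map_zero]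

omit [Fintype F] in
lemma one_mulChar_eq_zero_or_one (r : F) :
    (1 : MulChar F ℤ) r = 0 ∨ (1 : MulChar F ℤ) r = 1 := by
  by_cases h : r = 0
  · exact .inl (h ▸ MulChar.map_zero _)
  · exact .inr (MulChar.one_apply (Ne.isUnit h))

omit [Fintype F] [Fact (∀ r, r ^ 2 ≠ a + b * r)] in
lemma weight_one_eq_zero_or_one : weight (1 : MulChar F ℤ) u v = 0 ∨ weight 1 u v = 1 := by
  simp only [weight, extChar]
  split_ifs
  · exact one_mulChar_eq_zero_or_one _
  · exact one_mulChar_eq_zero_or_one _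
  · exact .inl rfl

lemma abs_quadraticChar (r : F) : |quadraticChar F r| = (1 : MulChar F ℤ) r := by
  by_cases h : r = 0
  · simp [h, MulChar.map_zero]
  · rw [MulChar.one_apply (Ne.isUnit h)]
    rcases quadraticChar_dichotomy h with h | h <;> simp [h]

omit [Fact (∀ r, r ^ 2 ≠ a + b * r)] in
lemma abs_weight_quadraticChar : |weight (quadraticChar F) u v| = weight 1 u v := by
  simp only [weight, extChar, apply_ite abs, abs_quadraticChar, abs_zero]

lemma sum_mulChar_sq (hψ : ∀ r : F, r ≠ 0 → ψ r ^ 2 = 1) :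
    ∑ r, ψ r ^ 2 = (Fintype.card F : ℤ) - 1 := by
  rw [← sum_one_mulChar]
  refine sum_congr rfl fun r _ ↦ ?_
  by_cases h : r = 0
  · simp [h, MulChar.map_zero]
  · rw [hψ r h, MulChar.one_apply (Ne.isUnit h)]

lemma sum_weight_quadraticChar (hF : Fintype.card F % 4 = 3) (hu : u ≠ 0)
    (huv : ∀ r : F, v ≠ r • u) :
    ∑ z, weight (quadraticChar F) u z * weight (quadraticChar F) v z = 0 := by
  have hchar : ringChar F ≠ 2 := fun h ↦ by
    have := FiniteField.even_card_of_char_two h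
    omega
  have hneg : quadraticChar F (-1) = -1 := by
    rw [quadraticChar_neg_one_iff_not_isSquare, FiniteField.isSquare_neg_one_iff]
    exact not_not.2 hF
  rcases det_ne_zero_or_exists_smul hu huv with h | ⟨c, hc, rfl⟩
  · rw [sum_weight_mul_weight_of_det_ne_zero _ h, quadraticChar_sum_zero hchar, hneg]
    simp
  · rw [sum_weight_mul_weight_smul _ hu hc, quadraticChar_sum_zero hchar]
    simp

lemma sum_weight_one (hu : u ≠ 0) (huv : ∀ r : F, v ≠ r • u) :
    ∑ z, weight (1 : MulChar F ℤ) u z * weight 1 v z =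
      ((Fintype.card F : ℤ) - 1) * ((Fintype.card F : ℤ) + 1 - 2 * weight 1 u v) := by
  rcases det_ne_zero_or_exists_smul hu huv with h | ⟨c, hc, rfl⟩
  · rw [sum_weight_mul_weight_of_det_ne_zero _ h, sum_one_mulChar,
      sum_mulChar_sq _ fun r hr ↦ by simp [MulChar.one_apply (Ne.isUnit hr)],
      MulChar.one_apply isUnit_one.neg, weight, if_neg h, extChar]
    by_cases h0 : (det u v).im = 0
    · have hre : (det u v).re ≠ 0 := fun hre ↦ h (QuadraticAlgebra.ext hre h0)
      rw [if_pos h0, im_inv_eq_zero.2 h0, MulChar.map_zero, MulChar.one_apply (Ne.isUnit hre)]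
      ring
    · rw [if_neg h0, MulChar.one_apply (Ne.isUnit (im_inv_eq_zero.not.2 h0))]
      ring
  · rw [sum_weight_mul_weight_smul _ hu hc, sum_one_mulChar, weight_smul_self _ hu,
      MulChar.one_apply (Ne.isUnit hc)]
    ring

end QuadraticPlane

namespace Projectivization

open scoped LinearAlgebra.Projectivization

lemma sum_eq_card_sub_one_mul_sum_rep {k V : Type*} [Field k] [Fintype k] [AddCommGroup V]
    [Module k V] [Fintype V] [Fintype (ℙ k V)] (g : V → ℤ) (h0 : g 0 = 0)
    (hg : ∀ r : k, r ≠ 0 → ∀ z, g (r • z) = g z) :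
    ∑ z, g z = ((Fintype.card k : ℤ) - 1) * ∑ P : ℙ k V, g P.rep := by
  classical
  have hcard : ((Fintype.card k : ℤ) - 1) = Fintype.card kˣ := by
    rw [Fintype.card_units, Nat.cast_pred Fintype.card_pos]
  have hsum : ∑ p : kˣ × ℙ k V, g p.2.rep = Fintype.card kˣ * ∑ P : ℙ k V, g P.rep := by
    rw [Fintype.sum_prod_type]
    simp
  rw [hcard, ← hsum]
  symm
  refine Finset.sum_of_injOn (fun p : kˣ × ℙ k V ↦ p.1 • p.2.rep) ?_ (by simp) ?_ ?_
  · rintro ⟨r, P⟩ - ⟨s, Q⟩ - h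
    simp only at h
    have hPQ : P = Q := by
      rw [← P.mk_rep, ← Q.mk_rep, mk_eq_mk_iff]
      exact ⟨r⁻¹ * s, by rw [mul_smul, ← h, inv_smul_smul]⟩
    subst hPQ
    have : (r : k) = s := smul_left_injective k P.rep_nonzero h
    rw [Units.ext this]
  · intro z _ hz
    by_cases hz0 : z = 0
    · rw [hz0, h0]
    · refine absurd ?_ hz
      obtain ⟨r, hr⟩ := exists_smul_eq_mk_rep k z hz0
      exact ⟨(r⁻¹, mk k z hz0), by simp, by simp [← hr]⟩
  · rintro ⟨r, P⟩ -
    exact (hg r r.ne_zero _).symm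

end Projectivization

namespace QuadraticPlane

open QuadraticAlgebra Finset
open scoped LinearAlgebra.Projectivization

variable {F : Type*} [Field F] [Fintype F] [DecidableEq F] {a b : F}
  [Fact (∀ r, r ^ 2 ≠ a + b * r)]

/-- The matrix of weights between the points of the projective space over `F` underlying the plane
over the quadratic extension. -/
noncomputable def weightMatrix (a b : F) [Fact (∀ r, r ^ 2 ≠ a + b * r)] (ψ : MulChar F ℤ) :
    Matrix (ℙ F (QuadraticAlgebra F a b × QuadraticAlgebra F a b))
      (ℙ F (QuadraticAlgebra F a b × QuadraticAlgebra F a b)) ℤ :=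
  Matrix.of fun P Q ↦ weight ψ P.rep Q.rep

omit [DecidableEq F] [Fact (∀ r, r ^ 2 ≠ a + b * r)] in
lemma card_points :
    Nat.card (ℙ F (QuadraticAlgebra F a b × QuadraticAlgebra F a b)) =
      1 + Fintype.card F + Fintype.card F ^ 2 + Fintype.card F ^ 3 := by
  rw [Projectivization.card_of_finrank F _ (n := 4)
    (by rw [Module.finrank_prod, finrank_eq_two])]
  simp [Finset.sum_range_succ]

omit [Fintype F] [DecidableEq F] [Fact (∀ r, r ^ 2 ≠ a + b * r)] in
lemma rep_ne_smul_rep {P Q : ℙ F (QuadraticAlgebra F a b × QuadraticAlgebra F a b)} (h : P ≠ Q)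
    (r : F) : Q.rep ≠ r • P.rep := by
  intro hr
  apply h
  rw [← P.mk_rep, ← Q.mk_rep, eq_comm, Projectivization.mk_eq_mk_iff']
  exact ⟨r, hr.symm⟩

variable [Fintype (ℙ F (QuadraticAlgebra F a b × QuadraticAlgebra F a b))]

lemma card_sub_one_mul_sum_weightMatrix (ψ : MulChar F ℤ) (hψ : ∀ r : F, r ≠ 0 → ψ r ^ 2 = 1)
    (P Q : ℙ F (QuadraticAlgebra F a b × QuadraticAlgebra F a b)) :
    ((Fintype.card F : ℤ) - 1) * ∑ R, weightMatrix a b ψ P R * weightMatrix a b ψ Q R =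
      ∑ z, weight ψ P.rep z * weight ψ Q.rep z := by
  refine (Projectivization.sum_eq_card_sub_one_mul_sum_rep (k := F)
    (fun z ↦ weight ψ P.rep z * weight ψ Q.rep z) ?_ fun r hr z ↦ ?_).symm
  · simp [weight_zero_right ψ P.rep_nonzero]
  · simp only [weight_smul_right ψ r P.rep_nonzero, weight_smul_right ψ r Q.rep_nonzero]
    linear_combination weight ψ P.rep z * weight ψ Q.rep z * hψ r hr

omit [DecidableEq F] in
lemma card_sub_one_ne_zero : (Fintype.card F : ℤ) - 1 ≠ 0 := by
  have := Fintype.one_lt_card (α := F)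
  lia

lemma weightMatrix_mul_transpose_apply_self (ψ : MulChar F ℤ)
    (hψ : ∀ r : F, r ≠ 0 → ψ r ^ 2 = 1)
    (P : ℙ F (QuadraticAlgebra F a b × QuadraticAlgebra F a b)) :
    (weightMatrix a b ψ * (weightMatrix a b ψ)ᵀ) P P =
      Fintype.card F + (Fintype.card F : ℤ) ^ 2 := by
  apply mul_left_cancel₀ (card_sub_one_ne_zero (F := F))
  simp only [mul_apply, transpose_apply]
  rw [card_sub_one_mul_sum_weightMatrix ψ hψ, sum_weight_sq _ P.rep_nonzero, sum_mulChar_sq ψ hψ]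
  ring

lemma weightMatrix_quadraticChar_mul_transpose
    [DecidableEq (ℙ F (QuadraticAlgebra F a b × QuadraticAlgebra F a b))]
    (hF : Fintype.card F % 4 = 3) :
    weightMatrix a b (quadraticChar F) * (weightMatrix a b (quadraticChar F))ᵀ =
      (Fintype.card F + (Fintype.card F : ℤ) ^ 2) • 1 := by
  have hψ (r : F) (hr : r ≠ 0) := quadraticChar_sq_one hr
  ext P Q
  by_cases h : P = Q
  · subst h
    rw [weightMatrix_mul_transpose_apply_self _ hψ]
    simp only [Matrix.smul_apply, one_apply_eq, smul_eq_mul, mul_one]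
  · apply mul_left_cancel₀ (card_sub_one_ne_zero (F := F))
    simp only [mul_apply, transpose_apply]
    rw [card_sub_one_mul_sum_weightMatrix _ hψ,
      sum_weight_quadraticChar hF P.rep_nonzero (rep_ne_smul_rep h)]
    simp only [Matrix.smul_apply, one_apply_ne h, smul_zero, mul_zero]

omit [Fintype (ℙ F (QuadraticAlgebra F a b × QuadraticAlgebra F a b))] in
lemma weightMatrix_quadraticChar_map_abs :
    (weightMatrix a b (quadraticChar F)).map (fun t ↦ |t|) = weightMatrix a b 1 := by
  ext P Q
  exact abs_weight_quadraticChar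

omit [Fintype F] [Fintype (ℙ F (QuadraticAlgebra F a b × QuadraticAlgebra F a b))] in
lemma weightMatrix_one_isSymm : (weightMatrix a b 1).IsSymm := by
  ext P Q
  exact weight_one_comm Q.rep_nonzero P.rep_nonzero

lemma isSRGAdj_weightMatrix_one
    [DecidableEq (ℙ F (QuadraticAlgebra F a b × QuadraticAlgebra F a b))] :
    IsSRGAdj (weightMatrix a b 1) (Fintype.card F + (Fintype.card F : ℤ) ^ 2)
      ((Fintype.card F : ℤ) - 1) ((Fintype.card F : ℤ) + 1) := by
  have hψ (r : F) (hr : r ≠ 0) : (1 : MulChar F ℤ) r ^ 2 = 1 := by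
    simp [MulChar.one_apply (Ne.isUnit hr)]
  have hdiag (P : ℙ F (QuadraticAlgebra F a b × QuadraticAlgebra F a b)) :
      weightMatrix a b 1 P P = 0 := weight_one_self P.rep_nonzero
  refine ⟨weightMatrix_one_isSymm, hdiag, fun P Q ↦ weight_one_eq_zero_or_one, ?_⟩
  conv_lhs => enter [2]; rw [← (weightMatrix_one_isSymm (a := a) (b := b)).eq]
  ext P Q
  by_cases h : P = Q
  · subst h
    rw [weightMatrix_mul_transpose_apply_self _ hψ]
    simp only [Matrix.add_apply, Matrix.sub_apply, Matrix.smul_apply, one_apply_eq, hdiag, allOnes,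
      of_apply, smul_eq_mul]
    ring
  · apply mul_left_cancel₀ (card_sub_one_ne_zero (F := F))
    simp only [mul_apply, transpose_apply]
    rw [card_sub_one_mul_sum_weightMatrix _ hψ,
      sum_weight_one P.rep_nonzero (rep_ne_smul_rep h)]
    simp only [Matrix.add_apply, Matrix.sub_apply, Matrix.smul_apply, one_apply_ne h, allOnes,
      weightMatrix, of_apply, smul_eq_mul]
    ring

end QuadraticPlane

lemma IsSRGAdj.submatrix {ι κ : Type*} [Fintype ι] [DecidableEq ι] [Fintype κ] [DecidableEq κ]
    {A : Matrix ι ι ℤ} {k l mu : ℤ} (h : IsSRGAdj A k l mu) (e : κ ≃ ι) :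
    IsSRGAdj (A.submatrix e e) k l mu := by
  obtain ⟨hs, hd, h01, hsq⟩ := h
  refine ⟨hs.submatrix e, fun i ↦ hd _, fun i j ↦ h01 _ _, ?_⟩
  rw [submatrix_mul_equiv, hsq]
  ext i j
  simp only [Matrix.add_apply, Matrix.sub_apply, Matrix.smul_apply, submatrix_apply, one_apply,
    allOnes, of_apply, e.injective.eq_iff]

theorem stmt0 (p r q : ℕ) (hp : p.Prime) (hr : 1 ≤ r) (hq : q = p ^ r)
    (hmod : q % 4 = 3) :
    ∃ W : Matrix (Fin (1 + q + q ^ 2 + q ^ 3)) (Fin (1 + q + q ^ 2 + q ^ 3)) ℤ,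
      (∀ i j, W i j = -1 ∨ W i j = 0 ∨ W i j = 1) ∧
      W * Wᵀ = ((q : ℤ) + (q : ℤ) ^ 2) • 1 ∧
      IsSRGAdj (W.map fun t => |t|) ((q : ℤ) + (q : ℤ) ^ 2) ((q : ℤ) - 1) ((q : ℤ) + 1) := by
  classical
  have : Fact p.Prime := ⟨hp⟩
  let F := GaloisField p r
  have : Fintype F := Fintype.ofFinite F
  have hF : Fintype.card F = q := by
    rw [hq, ← GaloisField.card p r (by lia), Nat.card_eq_fintype_card]
  have : Fact (∀ s : F, s ^ 2 ≠ -1 + 0 * s) := ⟨fun s hs ↦ by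
    have hsq : IsSquare (-1 : F) := ⟨s, by rw [← sq, hs]; ring⟩
    exact FiniteField.isSquare_neg_one_iff.1 hsq (hF ▸ hmod)⟩
  let V := Projectivization F (QuadraticAlgebra F (-1) 0 × QuadraticAlgebra F (-1) 0)
  have : Fintype V := Fintype.ofFinite V
  have hV : Fintype.card V = 1 + q + q ^ 2 + q ^ 3 := by
    rw [← Nat.card_eq_fintype_card, QuadraticPlane.card_points, hF]
  let e : Fin (1 + q + q ^ 2 + q ^ 3) ≃ V := (Fintype.equivFinOfCardEq hV).symm
  let M : Matrix V V ℤ := QuadraticPlane.weightMatrix (-1) 0 (quadraticChar F)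
  have habs : M.map (fun t ↦ |t|) = QuadraticPlane.weightMatrix (-1) 0 1 := QuadraticPlane.weightMatrix_quadraticChar_map_abs
  have hsrg : IsSRGAdj (M.map fun t ↦ |t|) ((q : ℤ) + (q : ℤ) ^ 2) ((q : ℤ) - 1)
      ((q : ℤ) + 1) := by
    rw [habs, ← hF]
    exact QuadraticPlane.isSRGAdj_weightMatrix_one
  refine ⟨M.submatrix e e, fun i j ↦ ?_, ?_, hsrg.submatrix e⟩
  · have := hsrg.2.2.1 (e i) (e j)
    simp only [map_apply, abs_eq_zero, abs_eq (zero_le_one' ℤ)] at this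
    simp only [submatrix_apply]
    tauto
  · have hM : M * Mᵀ = ((q : ℤ) + (q : ℤ) ^ 2) • 1 := by
      rw [← hF]
      exact QuadraticPlane.weightMatrix_quadraticChar_mul_transpose (a := -1) (b := 0) (hF ▸ hmod)
    rw [transpose_submatrix, submatrix_mul_equiv, hM]
    ext i j
    simp only [Matrix.smul_apply, submatrix_apply, one_apply, e.injective.eq_iff]
end

section
/- Let q be a prime power with q ≡ 3 (mod 4), set v = 1 + q + q² + q³, index rows and columns by pairs (i,a) with i ∈ {1,…,1+q²} and a ∈ {1,…,1+q}, and let D be the (0,1)-matrix with D((i,a),(j,b)) = 1 iff i = j and a ≠ b (the disjoint union of 1+q² cliques of size 1+q). Then there exist v×v integer matrices W₀, W₁, …, W_q, each with entries in {−1,0,1}, such that for every ℓ: W_ℓ·W_ℓᵀ = (q+q²)·I and |W_ℓ| is the adjacency matrix of an SRG(v, q+q², q−1, q+1); moreover every entry of D is ≤ the corresponding entry of each |W_ℓ|, and ∑_{ℓ=0}^{q} |W_ℓ| = (J − I) + q·D. (That is, the complete graph K_v decomposes into 1+q Siamese signed strongly regular graphs sharing the 1+q² cliques of size 1+q.) 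-/
open Matrix

/-- The disjoint union of `1 + q²` cliques of size `1 + q`, with vertices indexed by
pairs `(i, a)`: entry `((i,a),(j,b))` is `1` iff `i = j` and `a ≠ b`. -/
def cliques (q : ℕ) :
    Matrix (Fin (1 + q ^ 2) × Fin (1 + q)) (Fin (1 + q ^ 2) × Fin (1 + q)) ℤ :=
  Matrix.of fun x y => if x.1 = y.1 ∧ x.2 ≠ y.2 then 1 else 0

section

open Finset

/-- Representatives of the classes of nonzero elements of a quadratic extension of `F`
modulo scalars from `F`. -/
def projRep {F : Type*} [Field F] {a b : F} : Option F → QuadraticAlgebra F a b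
  | none => ⟨0, 1⟩
  | some t => ⟨1, t⟩

/-- The determinant of the standard representatives of two points of the projective line. -/
def lineDet {K : Type*} [Field K] : Option K → Option K → K
  | none, none => 0
  | none, some _ => -1
  | some _, none => 1
  | some m, some n => n - m

/-- The character `η` on the base field, extended by zero to a quadratic extension. -/
def extendChar {F : Type*} [Field F] [DecidableEq F] {a b : F} (η : MulChar F ℤ)
    (w : QuadraticAlgebra F a b) : ℤ :=
  if w.im = 0 then η w.re else 0

/-- The symplectic graph attached to the multiplier `δ`, signed by the character `η`. -/
def signedSymplectic {F : Type*} [Field F] [DecidableEq F] {a b : F}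
    [Fact (∀ r, r ^ 2 ≠ a + b * r)] (η : MulChar F ℤ) (δ : Option F)
    (x y : Option (QuadraticAlgebra F a b) × Option F) : ℤ :=
  if x.1 = y.1 then η (projRep y.2 / projRep x.2 : QuadraticAlgebra F a b).im
  else extendChar η (projRep δ * projRep x.2 * projRep y.2 * lineDet x.1 y.1)

section lineDet

variable {K : Type*} [Field K]

lemma lineDet_self (i : Option K) : lineDet i i = 0 := by
  cases i <;> simp [lineDet]

lemma lineDet_swap (i j : Option K) : lineDet j i = -lineDet i j := by
  cases i <;> cases j <;> simp [lineDet]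

lemma lineDet_ne_zero {i j : Option K} (h : i ≠ j) : lineDet i j ≠ 0 := by
  cases i <;> cases j <;> simp_all [lineDet, sub_eq_zero, eq_comm]

lemma lineDet_plucker (i j k l : Option K) :
    lineDet i j * lineDet k l - lineDet i l * lineDet k j = lineDet i k * lineDet j l := by
  rcases i with _ | i <;> rcases j with _ | j <;> rcases k with _ | k <;> rcases l with _ | l
  all_goals
    simp [lineDet]
    try ring

end lineDet

lemma sum_option_of_injOn {S : Type*} [Fintype S] [DecidableEq S] (g : Option S → S)
    (k : Option S) (hg : ∀ i j, i ≠ k → j ≠ k → g i = g j → i = j) (φ : S → ℤ)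
    (hφ : φ (g k) = 0) : ∑ j, φ (g j) = ∑ w, φ w := by
  rw [← Finset.add_sum_erase univ _ (mem_univ k), hφ, zero_add]
  have hinj : Set.InjOn g (univ.erase k : Finset (Option S)) := by
    intro i hi j hj h
    exact hg i j (by simpa using hi) (by simpa using hj) h
  have himg : (univ.erase k).image g = univ := by
    rw [← Finset.card_eq_iff_eq_univ, Finset.card_image_of_injOn hinj]
    simp [Finset.card_erase_of_mem]
  rw [← himg, Finset.sum_image hinj]

section quadratic

variable {F : Type*} [Field F] {a b : F}

lemma projRep_ne_zero (o : Option F) : (projRep o : QuadraticAlgebra F a b) ≠ 0 := by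
  cases o <;> simp [projRep, QuadraticAlgebra.ext_iff]

lemma exists_projRep_eq_smul {w : QuadraticAlgebra F a b} (hw : w ≠ 0) :
    ∃ (o : Option F) (f : F), f ≠ 0 ∧ (projRep o : QuadraticAlgebra F a b) = f • w := by
  by_cases h : w.re = 0
  · have h' : w.im ≠ 0 := fun h' => hw (by ext <;> simp [h, h'])
    exact ⟨none, w.im⁻¹, inv_ne_zero h', by ext <;> simp [projRep, h, h']⟩
  · exact ⟨some (w.re⁻¹ * w.im), w.re⁻¹, inv_ne_zero h, by ext <;> simp [projRep, h]⟩

lemma eq_of_projRep_eq_smul {o o' : Option F} {f : F}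
    (h : (projRep o' : QuadraticAlgebra F a b) = f • projRep o) : o' = o := by
  rw [QuadraticAlgebra.ext_iff] at h
  rcases o with _ | s <;> rcases o' with _ | t <;> simp only [projRep, QuadraticAlgebra.re_smul,
    QuadraticAlgebra.im_smul, smul_eq_mul, mul_one, mul_zero] at h
  · rfl
  · exact absurd h.1 one_ne_zero
  · obtain ⟨h1, h2⟩ := h
    rw [← h1, zero_mul] at h2
    exact absurd h2 one_ne_zero
  · obtain ⟨h1, h2⟩ := h
    rw [h2, ← h1, one_mul]

lemma smul_mul_eq (f : F) (x y : QuadraticAlgebra F a b) : (f • x) * y = f • (x * y) :=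
  smul_mul_assoc f x y

lemma eq_zero_of_im_eq_zero {w : QuadraticAlgebra F a b} (h : w.im = 0) :
    w = w.re • (1 : QuadraticAlgebra F a b) := by
  ext
  · change w.re = w.re * 1
    simp
  · change w.im = w.re * 0
    simp [h]

lemma extendChar_smul [DecidableEq F] (η : MulChar F ℤ) (f : F) (hf : f ≠ 0)
    (w : QuadraticAlgebra F a b) :
    extendChar η (f • w) = η f * extendChar η w := by
  simp [extendChar, hf]

lemma extendChar_zero [DecidableEq F] (η : MulChar F ℤ) :
    extendChar η (0 : QuadraticAlgebra F a b) = 0 := by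
  simp [extendChar, MulChar.map_zero]

lemma sum_extendChar [DecidableEq F] (η : MulChar F ℤ) [Fintype F]
    [Fintype (QuadraticAlgebra F a b)] :
    ∑ w : QuadraticAlgebra F a b, extendChar η w = ∑ f, η f := by
  rw [← Equiv.sum_comp (QuadraticAlgebra.equivProd a b).symm, Fintype.sum_prod_type]
  refine Finset.sum_congr rfl fun f _ => ?_
  rw [Finset.sum_eq_single 0]
  · simp [extendChar, QuadraticAlgebra.equivProd]
  · intro t _ ht
    simp [extendChar, QuadraticAlgebra.equivProd, ht]
  · simp

lemma one_mulChar_apply [DecidableEq F] (f : F) :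
    (1 : MulChar F ℤ) f = if f = 0 then 0 else 1 := by
  split_ifs with h
  · rw [h, MulChar.map_zero]
  · exact MulChar.one_apply (isUnit_iff_ne_zero.2 h)

lemma one_mulChar_mul_self [DecidableEq F] (f : F) (hf : f ≠ 0) :
    (1 : MulChar F ℤ) f * (1 : MulChar F ℤ) f = 1 := by
  simp [one_mulChar_apply, hf]

lemma extendChar_one_apply [DecidableEq F] {w : QuadraticAlgebra F a b} (hw : w ≠ 0) :
    extendChar 1 w = if w.im = 0 then 1 else 0 := by
  rw [extendChar]
  split_ifs with h
  · rw [one_mulChar_apply, if_neg fun h' => hw (by ext <;> simp [h, h'])]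
  · rfl

variable [Fact (∀ r, r ^ 2 ≠ a + b * r)]

lemma im_inv_eq_zero_iff {w : QuadraticAlgebra F a b} : (w⁻¹).im = 0 ↔ w.im = 0 := by
  have key : ∀ u : QuadraticAlgebra F a b, u.im = 0 → (u⁻¹).im = 0 := by
    intro u hu
    change (QuadraticAlgebra.norm u)⁻¹ • (star u).im = 0
    simp [hu]
  exact ⟨fun h => by simpa using key _ h, key w⟩

lemma im_projRep_div_eq_zero_iff {o o' : Option F} :
    (projRep o' / projRep o : QuadraticAlgebra F a b).im = 0 ↔ o' = o := by
  constructor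
  · intro h
    apply eq_of_projRep_eq_smul (a := a) (b := b)
      (f := (projRep o' / projRep o : QuadraticAlgebra F a b).re)
    have h2 := eq_zero_of_im_eq_zero h
    rw [div_eq_iff (projRep_ne_zero o)] at h2
    rwa [smul_mul_eq, one_mul] at h2
  · rintro rfl
    rw [div_self (projRep_ne_zero _)]
    rfl

variable [DecidableEq F] (η : MulChar F ℤ)

lemma extendChar_projRep_div (o o' : Option F) :
    extendChar η (projRep o' / projRep o : QuadraticAlgebra F a b) =
      if o' = o then 1 else 0 := by
  simp only [extendChar, im_projRep_div_eq_zero_iff]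
  split_ifs with h
  · subst h
    rw [div_self (projRep_ne_zero _)]
    exact map_one η
  · rfl

lemma abs_signedSymplectic [DecidableEq (QuadraticAlgebra F a b)]
    (hη : ∀ f, f ≠ 0 → η f * η f = 1) (δ : Option F)
    (x y : Option (QuadraticAlgebra F a b) × Option F) :
    |signedSymplectic η δ x y| = signedSymplectic 1 δ x y := by
  have h : ∀ f, |η f| = (1 : MulChar F ℤ) f := by
    intro f
    rw [one_mulChar_apply]
    split_ifs with hf
    · rw [hf, MulChar.map_zero, abs_zero]
    · rcases mul_self_eq_one_iff.1 (hη f hf) with h | h <;> simp [h]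
  simp only [signedSymplectic, extendChar]
  split_ifs <;> simp [h]

lemma signedSymplectic_one_apply [DecidableEq (QuadraticAlgebra F a b)] (δ : Option F)
    (i k : Option (QuadraticAlgebra F a b)) (c d : Option F) :
    signedSymplectic 1 δ (i, c) (k, d) = if i = k then (if c = d then 0 else 1) else
      if (projRep δ * projRep c * projRep d * lineDet i k).im = 0 then 1 else 0 := by
  simp only [signedSymplectic]
  split_ifs with h1 h2 h2
  · rw [im_projRep_div_eq_zero_iff.2 h2.symm, MulChar.map_zero]
  · rw [one_mulChar_apply, if_neg (mt im_projRep_div_eq_zero_iff.1 (Ne.symm h2))]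
  all_goals
    rw [extendChar_one_apply (mul_ne_zero (mul_ne_zero (mul_ne_zero (projRep_ne_zero _)
      (projRep_ne_zero _)) (projRep_ne_zero _)) (lineDet_ne_zero h1))]
    first | exact if_pos h2 | exact if_neg h2

lemma signedSymplectic_one_symm [DecidableEq (QuadraticAlgebra F a b)] (δ : Option F)
    (x y : Option (QuadraticAlgebra F a b) × Option F) :
    signedSymplectic 1 δ x y = signedSymplectic 1 δ y x := by
  obtain ⟨i, c⟩ := x
  obtain ⟨k, d⟩ := y
  have h : projRep δ * projRep d * projRep c * lineDet k i =
      -(projRep δ * projRep c * projRep d * lineDet i k) := by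
    rw [lineDet_swap i k]
    ring
  rw [signedSymplectic_one_apply, signedSymplectic_one_apply, h, QuadraticAlgebra.im_neg]
  simp only [eq_comm (a := k), eq_comm (a := d), neg_eq_zero]

variable [Fintype F]

lemma sum_mul_extendChar (hη : ∀ f, f ≠ 0 → η f * η f = 1) (G : QuadraticAlgebra F a b → ℤ)
    (hG : ∀ f, f ≠ 0 → ∀ y, G (f • y) = η f * G y) {w : QuadraticAlgebra F a b} (hw : w ≠ 0) :
    ∑ o : Option F, G (projRep o) * extendChar η (projRep o * w) = G w⁻¹ := by
  obtain ⟨o, f, hf, h⟩ := exists_projRep_eq_smul (inv_ne_zero hw)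
  rw [Finset.sum_eq_single o]
  · rw [h, hG f hf, smul_mul_eq, extendChar_smul η f hf, inv_mul_cancel₀ hw]
    have h1 : extendChar η (1 : QuadraticAlgebra F a b) = 1 := by
      simp [extendChar, QuadraticAlgebra.im_one, QuadraticAlgebra.re_one]
    rw [h1]
    linear_combination G w⁻¹ * hη f hf
  · intro o' _ ho'
    have : (projRep o' * w : QuadraticAlgebra F a b).im ≠ 0 := by
      intro h0
      apply ho'
      have h2 := eq_zero_of_im_eq_zero h0
      set t := (projRep o' * w : QuadraticAlgebra F a b).re
      apply eq_of_projRep_eq_smul (a := a) (b := b) (f := t * f⁻¹)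
      rw [h, smul_smul, mul_assoc, inv_mul_cancel₀ hf, mul_one]
      rw [← eq_div_iff hw] at h2
      rw [h2, div_eq_mul_inv, smul_mul_eq, one_mul]
    rw [extendChar, if_neg this, mul_zero]
  · simp

lemma sum_char_im_mul_char_im (hη : ∀ f, f ≠ 0 → η f * η f = 1) (o o' : Option F)
    (h : o ≠ o') :
    ∑ c : Option F, η (projRep c / projRep o : QuadraticAlgebra F a b).im *
      η (projRep c / projRep o' : QuadraticAlgebra F a b).im = ∑ f, η f := by
  rw [← sum_option_of_injOn (fun c => (projRep c / projRep o : QuadraticAlgebra F a b).im /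
      (projRep c / projRep o' : QuadraticAlgebra F a b).im) o' _ η]
  · refine Finset.sum_congr rfl fun c _ => ?_
    by_cases hc : (projRep c / projRep o' : QuadraticAlgebra F a b).im = 0
    · simp [hc, MulChar.map_zero]
    · set t := (projRep c / projRep o' : QuadraticAlgebra F a b).im
      set s := (projRep c / projRep o : QuadraticAlgebra F a b).im
      have hs : η s = η (s / t) * η t := by rw [← map_mul, div_mul_cancel₀ _ hc]
      rw [hs, mul_assoc, hη t hc, mul_one]
  · rw [div_self (projRep_ne_zero _), QuadraticAlgebra.im_one, div_zero, MulChar.map_zero]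
  · intro c d hc hd hcd
    have hc' := mt (im_projRep_div_eq_zero_iff (a := a) (b := b)).1 hc
    have hd' := mt (im_projRep_div_eq_zero_iff (a := a) (b := b)).1 hd
    set t := (projRep c / projRep o' : QuadraticAlgebra F a b).im with ht
    set t' := (projRep d / projRep o' : QuadraticAlgebra F a b).im with ht'
    have key : ∀ u : Option F,
        ((projRep c - (t / t') • projRep d) / projRep u : QuadraticAlgebra F a b).im =
          (projRep c / projRep u : QuadraticAlgebra F a b).im -
            t / t' * (projRep d / projRep u : QuadraticAlgebra F a b).im := by
      intro u
      rw [sub_div, QuadraticAlgebra.im_sub, div_eq_mul_inv (_ • _), smul_mul_eq,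
        ← div_eq_mul_inv, QuadraticAlgebra.im_smul, smul_eq_mul]
    have h1 := key o
    have h2 := key o'
    rw [← ht, ← ht', div_mul_cancel₀ _ hd', sub_self] at h2
    have h3 : (projRep c / projRep o : QuadraticAlgebra F a b).im -
            t / t' * (projRep d / projRep o : QuadraticAlgebra F a b).im = 0 := by
      field_simp at hcd ⊢
      linear_combination hcd
    rw [h3] at h1
    set v : QuadraticAlgebra F a b := projRep c - (t / t') • projRep d with hv
    by_cases hv0 : v = 0
    · exact eq_of_projRep_eq_smul (sub_eq_zero.1 hv0)
    · exfalso
      obtain ⟨e, f, hf, he⟩ := exists_projRep_eq_smul hv0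
      have h4 : ∀ u : Option F, (v / projRep u).im = 0 → e = u := by
        intro u hu
        rw [← im_projRep_div_eq_zero_iff (a := a) (b := b), he, div_eq_mul_inv, smul_mul_eq,
          ← div_eq_mul_inv, QuadraticAlgebra.im_smul, hu, smul_zero]
      exact h ((h4 o h1).symm.trans (h4 o' h2))

lemma sum_signedSymplectic_one [DecidableEq (QuadraticAlgebra F a b)]
    (x y : Option (QuadraticAlgebra F a b) × Option F) :
    ∑ δ, signedSymplectic 1 δ x y = 1 - (if x = y then 1 else 0) +
      (Fintype.card F : ℤ) * if x.1 = y.1 ∧ x.2 ≠ y.2 then 1 else 0 := by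
  obtain ⟨i, c⟩ := x
  obtain ⟨k, d⟩ := y
  by_cases hik : i = k
  · subst hik
    simp only [signedSymplectic_one_apply]
    by_cases hcd : c = d <;> simp [hcd]
    ring
  · have hw : projRep c * projRep d * lineDet i k ≠ 0 :=
      mul_ne_zero (mul_ne_zero (projRep_ne_zero _) (projRep_ne_zero _)) (lineDet_ne_zero hik)
    have := sum_mul_extendChar 1 one_mulChar_mul_self (fun _ => 1)
      (fun f hf _ => by simp [one_mulChar_apply, hf]) hw
    simpa [signedSymplectic, hik, mul_assoc] using this

variable [DecidableEq (QuadraticAlgebra F a b)] [Fintype (QuadraticAlgebra F a b)]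

lemma sum_signedSymplectic_mul_of_ne (hη : ∀ f, f ≠ 0 → η f * η f = 1) (δ : Option F)
    (i k : Option (QuadraticAlgebra F a b)) (c d : Option F) (hik : i ≠ k) :
    ∑ y, signedSymplectic η δ (i, c) y * signedSymplectic η δ (k, d) y =
      (1 + η (-1)) * η (projRep δ * projRep c * projRep d * lineDet i k)⁻¹.im +
        ∑ f, η f := by
  have hδ := projRep_ne_zero (a := a) (b := b) δ
  have hc := projRep_ne_zero (a := a) (b := b) c
  have hd := projRep_ne_zero (a := a) (b := b) d
  have hik' := lineDet_ne_zero hik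
  set h : QuadraticAlgebra F a b := (projRep δ * projRep c * projRep d * lineDet i k)⁻¹ with hh
  have hchar : ∀ (u : QuadraticAlgebra F a b) (f : F), f ≠ 0 → ∀ y,
      η ((f • y) / u).im = η f * η (y / u).im := by
    intro u f hf y
    rw [div_eq_mul_inv, smul_mul_eq, ← div_eq_mul_inv, QuadraticAlgebra.im_smul, smul_eq_mul,
      map_mul]
  have hline : ∀ j, ∑ o, signedSymplectic η δ (i, c) (j, o) *
      signedSymplectic η δ (k, d) (j, o) =
      (if j = i then η (-1) * η h.im else 0) + (if j = k then η h.im else 0) +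
        extendChar η (projRep c / projRep d * (lineDet i j / lineDet k j)) := by
    intro j
    by_cases hji : j = i
    · subst hji
      have hw : projRep δ * projRep d * lineDet k j ≠ 0 :=
        mul_ne_zero (mul_ne_zero hδ hd) (lineDet_ne_zero hik.symm)
      have := sum_mul_extendChar η hη (fun y => η (y / projRep c).im) (hchar _) hw
      simp only [signedSymplectic, if_true, if_neg hik, if_neg hik.symm, lineDet_self,
        zero_div, mul_zero, extendChar_zero, add_zero]
      rw [← map_mul]
      convert this using 2
      · congr 2
        ring
      · rw [neg_one_mul, ← QuadraticAlgebra.im_neg, hh, lineDet_swap j k]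
        congr 1
        field_simp
    by_cases hjk : j = k
    · subst hjk
      have hw : projRep δ * projRep c * lineDet i j ≠ 0 :=
        mul_ne_zero (mul_ne_zero hδ hc) hik'
      have := sum_mul_extendChar η hη (fun y => η (y / projRep d).im) (hchar _) hw
      simp only [signedSymplectic, if_true, if_neg hik, if_neg hik.symm, lineDet_self,
        div_zero, mul_zero, extendChar_zero, add_zero, zero_add]
      convert this using 2
      · rw [mul_comm]
        congr 2
        ring
      · rw [hh]
        congr 1
        field_simp
    · have hjk' := lineDet_ne_zero (Ne.symm hjk)
      have hw : projRep δ * projRep d * lineDet k j ≠ 0 :=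
        mul_ne_zero (mul_ne_zero hδ hd) hjk'
      have := sum_mul_extendChar η hη
        (fun y => extendChar η (y * (projRep δ * projRep c * lineDet i j)))
        (fun f hf y => by rw [smul_mul_eq, extendChar_smul η f hf]) hw
      simp only [signedSymplectic, if_neg hji, if_neg hjk, if_neg (Ne.symm hji),
        if_neg (Ne.symm hjk), zero_add]
      convert this using 2
      · congr 2 <;> ring
      · field_simp
  rw [Fintype.sum_prod_type, Finset.sum_congr rfl fun j _ => hline j,
    Finset.sum_add_distrib, Finset.sum_add_distrib]
  rw [sum_option_of_injOn
    (fun j => projRep c / projRep d * (lineDet i j / lineDet k j)) k _ (extendChar η)]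
  · simp [sum_extendChar]
    ring
  · rw [lineDet_self, div_zero, mul_zero, extendChar_zero]
  · intro j l hj hl hjl
    have h1 := lineDet_ne_zero (Ne.symm hj)
    have h2 := lineDet_ne_zero (Ne.symm hl)
    have h3 := mul_left_cancel₀ (div_ne_zero hc hd) hjl
    rw [div_eq_div_iff h1 h2] at h3
    have h4 := lineDet_plucker i j k l
    rw [h3, sub_self] at h4
    by_contra hne
    exact mul_ne_zero hik' (lineDet_ne_zero hne) h4.symm

lemma sum_signedSymplectic_mul_same (hη : ∀ f, f ≠ 0 → η f * η f = 1) (δ : Option F)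
    (i : Option (QuadraticAlgebra F a b)) (c d : Option F) :
    ∑ y, signedSymplectic η δ (i, c) y * signedSymplectic η δ (i, d) y =
      (Fintype.card F : ℤ) ^ 2 * (if c = d then 1 else 0) +
        if c = d then (Fintype.card F : ℤ) else ∑ f, η f := by
  have hδ := projRep_ne_zero (a := a) (b := b) δ
  have hc := projRep_ne_zero (a := a) (b := b) c
  have hd := projRep_ne_zero (a := a) (b := b) d
  have hline : ∀ j, ∑ o, signedSymplectic η δ (i, c) (j, o) *
      signedSymplectic η δ (i, d) (j, o) =
      (if j = i then (if c = d then (Fintype.card F : ℤ) else ∑ f, η f) else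
        if c = d then 1 else 0) := by
    intro j
    by_cases hji : j = i
    · subst hji
      simp only [signedSymplectic, if_true]
      split_ifs with hcd
      · subst hcd
        have : ∀ o : Option F, η (projRep o / projRep c : QuadraticAlgebra F a b).im *
            η (projRep o / projRep c : QuadraticAlgebra F a b).im =
              1 - if o = c then 1 else 0 := by
          intro o
          split_ifs with hoc
          · rw [im_projRep_div_eq_zero_iff.2 hoc]
            simp [MulChar.map_zero]
          · rw [hη _ (mt im_projRep_div_eq_zero_iff.1 hoc), sub_zero]
        rw [Finset.sum_congr rfl fun o _ => this o]
        simp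
      · exact sum_char_im_mul_char_im η hη c d hcd
    · have hji' := lineDet_ne_zero (Ne.symm hji)
      have hw : projRep δ * projRep d * lineDet i j ≠ 0 :=
        mul_ne_zero (mul_ne_zero hδ hd) hji'
      have := sum_mul_extendChar η hη
        (fun y => extendChar η (y * (projRep δ * projRep c * lineDet i j)))
        (fun f hf y => by rw [smul_mul_eq, extendChar_smul η f hf]) hw
      simp only [signedSymplectic, if_neg hji, if_neg (Ne.symm hji)]
      rw [← extendChar_projRep_div (a := a) (b := b) η]
      convert this using 2
      · congr 2 <;> ring
      · field_simp
  have hcard : Fintype.card (QuadraticAlgebra F a b) = Fintype.card F ^ 2 := by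
    rw [Fintype.card_congr (QuadraticAlgebra.equivProd a b), Fintype.card_prod, sq]
  rw [Fintype.sum_prod_type, Finset.sum_congr rfl fun j _ => hline j]
  rw [← Finset.add_sum_erase univ _ (mem_univ i),
    Finset.sum_congr rfl (g := fun _ => (if c = d then 1 else 0 : ℤ))
      fun j hj => if_neg (Finset.ne_of_mem_erase hj)]
  simp only [if_true, Finset.sum_const, Finset.card_erase_of_mem (mem_univ i), Finset.card_univ,
    Fintype.card_option, hcard]
  simp
  ring

lemma sum_signedSymplectic_mul (hη : ∀ f, f ≠ 0 → η f * η f = 1) (hneg : η (-1) = -1)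
    (hsum : ∑ f, η f = 0) (δ : Option F) (x z : Option (QuadraticAlgebra F a b) × Option F) :
    ∑ y, signedSymplectic η δ x y * signedSymplectic η δ z y =
      ((Fintype.card F : ℤ) + (Fintype.card F : ℤ) ^ 2) * if x = z then 1 else 0 := by
  obtain ⟨i, c⟩ := x
  obtain ⟨k, d⟩ := z
  by_cases hik : i = k
  · subst hik
    rw [sum_signedSymplectic_mul_same η hη, hsum]
    by_cases hcd : c = d
    · simp [hcd]
      ring
    · simp [hcd]
  · rw [sum_signedSymplectic_mul_of_ne η hη _ _ _ _ _ hik, hneg, hsum]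
    simp [hik]

lemma signedSymplectic_one_mul_self (δ : Option F)
    (x z : Option (QuadraticAlgebra F a b) × Option F) :
    ∑ y, signedSymplectic 1 δ x y * signedSymplectic 1 δ y z =
      ((Fintype.card F : ℤ) + (Fintype.card F : ℤ) ^ 2) * (if x = z then 1 else 0) +
        ((Fintype.card F : ℤ) - 1) * signedSymplectic 1 δ x z +
        ((Fintype.card F : ℤ) + 1) *
          (1 - (if x = z then 1 else 0) - signedSymplectic 1 δ x z) := by
  have hsum : ∑ f : F, (1 : MulChar F ℤ) f = (Fintype.card F : ℤ) - 1 := by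
    rw [Finset.sum_congr rfl fun f _ => one_mulChar_apply f, Finset.sum_ite]
    simp [Finset.filter_ne', Finset.card_erase_of_mem, Nat.cast_pred Fintype.card_pos]
  simp_rw [signedSymplectic_one_symm δ _ z]
  rw [signedSymplectic_one_symm δ z x]
  obtain ⟨i, c⟩ := x
  obtain ⟨k, d⟩ := z
  rw [signedSymplectic_one_apply]
  by_cases hik : i = k
  · subst hik
    rw [sum_signedSymplectic_mul_same 1 one_mulChar_mul_self, hsum]
    by_cases hcd : c = d
    · simp [hcd]
      ring
    · simp [hcd]
  · rw [sum_signedSymplectic_mul_of_ne 1 one_mulChar_mul_self _ _ _ _ _ hik, hsum,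
      one_mulChar_apply, one_mulChar_apply]
    simp only [im_inv_eq_zero_iff, neg_eq_zero, one_ne_zero, if_false, Prod.mk.injEq, hik,
      false_and]
    split_ifs <;> ring

end quadratic

end

theorem stmt1 (p r q : ℕ) (hp : p.Prime) (hr : 1 ≤ r) (hq : q = p ^ r)
    (hmod : q % 4 = 3) :
    ∃ W : Fin (q + 1) →
        Matrix (Fin (1 + q ^ 2) × Fin (1 + q)) (Fin (1 + q ^ 2) × Fin (1 + q)) ℤ,
      (∀ ℓ, (∀ x y, W ℓ x y = -1 ∨ W ℓ x y = 0 ∨ W ℓ x y = 1) ∧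
        W ℓ * (W ℓ)ᵀ = ((q : ℤ) + (q : ℤ) ^ 2) • 1 ∧
        IsSRGAdj ((W ℓ).map fun t => |t|)
          ((q : ℤ) + (q : ℤ) ^ 2) ((q : ℤ) - 1) ((q : ℤ) + 1)) ∧
      (∀ ℓ x y, cliques q x y ≤ |W ℓ x y|) ∧
      (∑ ℓ, (W ℓ).map fun t => |t|) =
        (allOnes (Fin (1 + q ^ 2) × Fin (1 + q)) - 1) + (q : ℤ) • cliques q := by
  have : Fact p.Prime := ⟨hp⟩
  let F := GaloisField p r
  let _ : Fintype F := Fintype.ofFinite F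
  let _ : DecidableEq F := Classical.decEq F
  have hF : Fintype.card F = q := by
    rw [← Nat.card_eq_fintype_card, GaloisField.card p r (by omega), hq]
  have hsq : ¬IsSquare (-1 : F) := by
    rw [FiniteField.isSquare_neg_one_iff, hF]
    omega
  have hirr : Fact (∀ t : F, t ^ 2 ≠ -1 + 0 * t) :=
    ⟨fun t ht => hsq ⟨t, by linear_combination -ht⟩⟩
  have hchar : ringChar F ≠ 2 := by
    intro h
    have := FiniteField.even_card_of_char_two h
    omega
  let L := QuadraticAlgebra F (-1) 0
  let _ : Fintype L := Fintype.ofEquiv _ (QuadraticAlgebra.equivProd (-1 : F) 0).symm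
  let _ : DecidableEq L := Classical.decEq L
  have hL : Fintype.card L = q ^ 2 := by
    rw [Fintype.card_congr (QuadraticAlgebra.equivProd (-1 : F) 0), Fintype.card_prod, hF, sq]
  let η : MulChar F ℤ := quadraticChar F
  have hη : ∀ f, f ≠ 0 → η f * η f = 1 := fun f hf => by
    rw [← sq]
    exact quadraticChar_sq_one hf
  have hneg : η (-1) = -1 := quadraticChar_neg_one_iff_not_isSquare.2 hsq
  have hsum : ∑ f, η f = 0 := quadraticChar_sum_zero hchar
  let eδ : Fin (q + 1) ≃ Option F := Fintype.equivOfCardEq (by simp [hF])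
  let e₁ : Fin (1 + q ^ 2) ≃ Option L := Fintype.equivOfCardEq (by simp [hL, add_comm])
  let e₂ : Fin (1 + q) ≃ Option F := Fintype.equivOfCardEq (by simp [hF, add_comm])
  let e := e₁.prodCongr e₂
  have habs : ∀ δ x y, |signedSymplectic η δ (e x) (e y)| = signedSymplectic 1 δ (e x) (e y) :=
    fun δ x y => abs_signedSymplectic η hη δ _ _
  have hone : ∀ δ x y, signedSymplectic 1 δ (e x) (e y) = 0 ∨
      signedSymplectic 1 δ (e x) (e y) = 1 := by
    intro δ x y
    rw [← Prod.mk.eta (p := e x), ← Prod.mk.eta (p := e y), signedSymplectic_one_apply]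
    split_ifs <;> simp
  refine ⟨fun ℓ => Matrix.of fun x y => signedSymplectic η (eδ ℓ) (e x) (e y),
    fun ℓ => ⟨?_, ?_, ?_, ?_, ?_, ?_⟩, ?_, ?_⟩
  · intro x y
    have h1 := habs (eδ ℓ) x y
    simp only [Matrix.of_apply]
    rcases hone (eδ ℓ) x y with h | h <;> rw [h] at h1
    · exact Or.inr (Or.inl (abs_eq_zero.1 h1))
    · rcases (abs_eq zero_le_one).1 h1 with h2 | h2
      · exact Or.inr (Or.inr h2)
      · exact Or.inl h2
  · ext x z
    have h := sum_signedSymplectic_mul η hη hneg hsum (eδ ℓ) (e x) (e z)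
    rw [← Equiv.sum_comp e] at h
    simp only [Matrix.mul_apply, Matrix.transpose_apply, Matrix.of_apply, Matrix.smul_apply,
      Matrix.one_apply, smul_eq_mul]
    rw [h, hF]
    simp only [EmbeddingLike.apply_eq_iff_eq]
  · ext x y
    simp only [Matrix.transpose_apply, Matrix.map_apply, Matrix.of_apply, habs]
    exact signedSymplectic_one_symm _ _ _
  · intro x
    simp only [Matrix.map_apply, Matrix.of_apply, habs]
    rw [← Prod.mk.eta (p := e x), signedSymplectic_one_apply]
    simp
  · intro x y
    simp only [Matrix.map_apply, Matrix.of_apply, habs]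
    exact hone _ _ _
  · ext x z
    have h := signedSymplectic_one_mul_self (eδ ℓ) (e x) (e z)
    rw [← Equiv.sum_comp e] at h
    simp only [Matrix.mul_apply, Matrix.map_apply, Matrix.of_apply, Matrix.smul_apply,
      Matrix.add_apply, Matrix.sub_apply, Matrix.one_apply, smul_eq_mul, allOnes, habs]
    rw [h, hF]
    simp only [EmbeddingLike.apply_eq_iff_eq]
  · intro ℓ x y
    simp only [cliques, Matrix.of_apply]
    split_ifs with h
    · rw [habs, ← Prod.mk.eta (p := e x), ← Prod.mk.eta (p := e y), signedSymplectic_one_apply]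
      simp [e, h.1, h.2]
    · exact abs_nonneg _
  · ext x y
    have h := sum_signedSymplectic_one (e x) (e y)
    rw [← Equiv.sum_comp eδ] at h
    simp only [Matrix.sum_apply, Matrix.map_apply, Matrix.of_apply, Matrix.smul_apply,
      Matrix.add_apply, Matrix.sub_apply, Matrix.one_apply, smul_eq_mul, allOnes, cliques, habs]
    rw [h, hF]
    simp only [EmbeddingLike.apply_eq_iff_eq]
    simp [e]
end

section
/- Let m, n, k, λ be positive integers with 2n ∣ m − 1. Suppose there exist (i) a BGW(m+1,m,m−1) over the cyclic group ℤ/2nℤ, encoded as a function c defined on ordered pairs of distinct elements of {0,1,…,m} with values in ℤ/2nℤ such that for all distinct i, j and every g ∈ ℤ/2nℤ, the number of indices ℓ ∉ {i,j} with c(i,ℓ) − c(j,ℓ) = g equals (m−1)/(2n); and (ii) a BGW(n,k,λ) over {1,−1}. Then there exists an ((m+1)n)×((m+1)n) integer matrix W, with rows and columns indexed by {0,…,m}×{1,…,n}, whose entries lie in {−1,0,1}, such that W·Wᵀ = mk·I, |W|·|W|ᵀ = |W|ᵀ·|W| = mk·I + mλ·(𝒥_{m+1,n} − I) + ((m−1)/n)k²·(J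 − 𝒥_{m+1,n}) (so |W| is the incidence matrix of an SGDD((m+1)n, mk, m+1, n, mλ, ((m−1)/n)k²)), and |W|·𝒥_{m+1,n} = 𝒥_{m+1,n}·|W| = k·(J − 𝒥_{m+1,n}). -/
open Matrix

/-- The matrix `𝒥_{m,n} = I_m ⊗ J_n`, with rows and columns indexed by pairs:
entry `((i,a),(j,b))` is `1` iff `i = j`. -/
def blockJ (m n : ℕ) : Matrix (Fin m × Fin n) (Fin m × Fin n) ℤ :=
  Matrix.of fun x y => if x.1 = y.1 then 1 else 0

/-- If an integer matrix commutes with its Gram matrix `A * Aᵀ`, then it is normal. -/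
theorem transpose_mul_self_eq_of_commute {ι : Type*} [Fintype ι] [DecidableEq ι]
    {A : Matrix ι ι ℤ} (h : Commute A (A * Aᵀ)) : Aᵀ * A = A * Aᵀ := by
  have htr : ((Aᵀ * A - A * Aᵀ)ᴴ * (Aᵀ * A - A * Aᵀ)).trace = 0 := by
    have h1 : (Aᵀ * A * (Aᵀ * A)).trace = (A * Aᵀ * (A * Aᵀ)).trace := by
      rw [Matrix.mul_assoc Aᵀ, Matrix.trace_mul_comm Aᵀ]
      simp only [Matrix.mul_assoc]
    have h2 : (A * Aᵀ * (Aᵀ * A)).trace = (A * Aᵀ * (A * Aᵀ)).trace := by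
      have h3 : A * Aᵀ * (Aᵀ * A) = A * Aᵀ * Aᵀ * A := by simp only [Matrix.mul_assoc]
      rw [h3, Matrix.trace_mul_comm, ← Matrix.mul_assoc, h.eq]
      simp only [Matrix.mul_assoc]
    have h4 : (Aᵀ * A * (A * Aᵀ)).trace = (A * Aᵀ * (A * Aᵀ)).trace := by
      rw [Matrix.trace_mul_comm, h2]
    simp only [Matrix.conjTranspose_eq_transpose_of_trivial, Matrix.transpose_sub,
      Matrix.transpose_mul, Matrix.transpose_transpose, Matrix.sub_mul, Matrix.mul_sub,
      Matrix.trace_sub, h1, h2, h4, sub_self]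
  exact sub_eq_zero.mp (Matrix.trace_conjTranspose_mul_self_eq_zero_iff.mp htr)

/-- For `u = -1` these are the powers of the negacyclic shift of order `2 * n`, and for `u = 1`
their entrywise absolute values. -/
def twistedShift (n : ℕ) (u : ℤ) (g : ZMod (2 * n)) : Matrix (Fin n) (Fin n) ℤ :=
  Matrix.of fun a b =>
    (if g + (a : ℕ) = ((b : ℕ) : ZMod (2 * n)) then 1 else 0) +
      u * (if g + (a : ℕ) = ((b : ℕ) : ZMod (2 * n)) + (n : ZMod (2 * n)) then 1 else 0)

theorem natCast_add_self_zmod_two_mul (n : ℕ) :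
    (n : ZMod (2 * n)) + (n : ZMod (2 * n)) = 0 := by
  have h := ZMod.natCast_self (2 * n)
  push_cast at h
  rw [← two_mul, h]

theorem sum_zmod_two_mul {n : ℕ} [NeZero (2 * n)] (F : ZMod (2 * n) → ℤ) :
    ∑ b : Fin n, (F (b : ℕ) + F ((b : ℕ) + (n : ZMod (2 * n)))) = ∑ z, F z := by
  have h1 : ∑ z, F z = ∑ i ∈ Finset.range (2 * n), F (i : ℕ) := by
    refine (Finset.sum_bij (fun (i : ℕ) _ => (i : ZMod (2 * n)))
      (fun _ _ => Finset.mem_univ _) ?_ ?_ fun _ _ => rfl).symm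
    · intro a ha b hb hab
      have := congrArg ZMod.val hab
      rwa [ZMod.val_cast_of_lt (Finset.mem_range.mp ha),
        ZMod.val_cast_of_lt (Finset.mem_range.mp hb)] at this
    · intro z _
      exact ⟨z.val, Finset.mem_range.mpr (ZMod.val_lt z), ZMod.natCast_zmod_val z⟩
  have h2 : ∀ N, N = n + n → ∑ i ∈ Finset.range N, F (i : ℕ) =
      ∑ i ∈ Finset.range n, F (i : ℕ) + ∑ i ∈ Finset.range n, F ((n + i : ℕ) : ZMod (2 * n)) := by
    rintro N rfl
    exact Finset.sum_range_add _ _ _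
  rw [h1, h2 _ (two_mul n), Finset.sum_add_distrib,
    Fin.sum_univ_eq_sum_range (fun i => F (i : ℕ)),
    Fin.sum_univ_eq_sum_range (fun i => F ((i : ℕ) + (n : ZMod (2 * n))))]
  congr 1
  refine Finset.sum_congr rfl fun i _ => ?_
  push_cast
  rw [add_comm]

theorem twistedShift_mul_transpose {n : ℕ} [NeZero (2 * n)] {u : ℤ} (hu : u * u = 1)
    (g h : ZMod (2 * n)) :
    twistedShift n u g * (twistedShift n u h)ᵀ = twistedShift n u (g - h) := by
  have hnn := natCast_add_self_zmod_two_mul n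
  ext a b
  simp only [Matrix.mul_apply, Matrix.transpose_apply, twistedShift, Matrix.of_apply]
  have hx : (g - h + (a : ℕ) = ((b : ℕ) : ZMod (2 * n))) ↔
      h + ((b : ℕ) : ZMod (2 * n)) = g + (a : ℕ) := by
    constructor <;> intro e <;> linear_combination -e
  have hy : (g - h + (a : ℕ) = ((b : ℕ) : ZMod (2 * n)) + (n : ZMod (2 * n))) ↔
      h + ((b : ℕ) : ZMod (2 * n)) = g + (a : ℕ) + (n : ZMod (2 * n)) := by
    constructor <;> intro e
    · linear_combination -e - hnn
    · linear_combination -e - hnn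
  simp only [hx, hy]
  generalize g + ((a : ℕ) : ZMod (2 * n)) = x
  generalize h + ((b : ℕ) : ZMod (2 * n)) = y
  have key := sum_zmod_two_mul (n := n) fun z =>
    (if x = z then (1 : ℤ) else 0) *
      ((if y = z then 1 else 0) + u * (if y = z + (n : ZMod (2 * n)) then 1 else 0))
  have hval : ∑ z, (if x = z then (1 : ℤ) else 0) *
      ((if y = z then 1 else 0) + u * (if y = z + (n : ZMod (2 * n)) then 1 else 0)) =
      (if y = x then 1 else 0) + u * (if y = x + (n : ZMod (2 * n)) then 1 else 0) := by
    simp only [ite_mul, one_mul, zero_mul, Finset.sum_ite_eq, Finset.mem_univ, if_true]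
  rw [← hval, ← key]
  refine Finset.sum_congr rfl fun b _ => ?_
  have hz : ((b : ℕ) : ZMod (2 * n)) + (n : ZMod (2 * n)) + (n : ZMod (2 * n)) = (b : ℕ) := by
    rw [add_assoc, hnn, add_zero]
  rw [hz]
  linear_combination (if x = ((b : ℕ) : ZMod (2 * n)) + (n : ZMod (2 * n)) then (1 : ℤ) else 0) *
    (if y = ((b : ℕ) : ZMod (2 * n)) + (n : ZMod (2 * n)) then 1 else 0) * hu

theorem twistedShift_zero {n : ℕ} [NeZero (2 * n)] (u : ℤ) : twistedShift n u 0 = 1 := by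
  have hval : ∀ a : ℕ, a < 2 * n → ((a : ℕ) : ZMod (2 * n)).val = a := fun a ha =>
    ZMod.val_cast_of_lt ha
  have hinj : ∀ a b : ℕ, a < 2 * n → b < 2 * n →
      (((a : ℕ) : ZMod (2 * n)) = (b : ℕ) ↔ a = b) := by
    intro a b ha hb
    refine ⟨fun e => ?_, fun e => by rw [e]⟩
    rw [← hval a ha, ← hval b hb, e]
  ext a b
  have ha := a.2
  have hb := b.2
  have h1 := hinj a b (by omega) (by omega)
  have h2 := hinj a (b + n) (by omega) (by omega)
  push_cast at h2
  have h3 : ¬ ((a : ℕ) = b + n) := by omega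
  simp [twistedShift, h1, h2, h3, Matrix.one_apply, Fin.ext_iff]

theorem sum_twistedShift {n : ℕ} [NeZero (2 * n)] (u : ℤ) :
    ∑ g, twistedShift n u g = (1 + u) • allOnes (Fin n) := by
  ext a b
  simp [Matrix.sum_apply, twistedShift, allOnes, Finset.sum_add_distrib,
    ← eq_sub_iff_add_eq]

theorem sum_twistedShift_one_row {n : ℕ} [NeZero (2 * n)] (g : ZMod (2 * n)) (a : Fin n) :
    ∑ b, twistedShift n 1 g a b = 1 := by
  have h := sum_zmod_two_mul (n := n) fun z => if g + ((a : ℕ) : ZMod (2 * n)) = z then (1 : ℤ) else 0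
  simpa [twistedShift] using h

theorem sum_twistedShift_one_col {n : ℕ} [NeZero (2 * n)] (g : ZMod (2 * n)) (b : Fin n) :
    ∑ a, twistedShift n 1 g a b = 1 := by
  have hnn := natCast_add_self_zmod_two_mul n
  have h := sum_zmod_two_mul (n := n) fun z =>
    if z = ((b : ℕ) : ZMod (2 * n)) - g then (1 : ℤ) else 0
  rw [Finset.sum_ite_eq', if_pos (Finset.mem_univ _)] at h
  refine Eq.trans (Finset.sum_congr rfl fun a _ => ?_) h
  have h1 : (g + (a : ℕ) = ((b : ℕ) : ZMod (2 * n)) + (n : ZMod (2 * n))) ↔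
      ((a : ℕ) : ZMod (2 * n)) + (n : ZMod (2 * n)) = (b : ℕ) - g := by
    constructor <;> intro e
    · linear_combination e + hnn
    · linear_combination e - hnn
  have h2 : (g + (a : ℕ) = ((b : ℕ) : ZMod (2 * n))) ↔
      ((a : ℕ) : ZMod (2 * n)) = (b : ℕ) - g := eq_sub_iff_add_eq'.symm
  simp only [twistedShift, Matrix.of_apply, h1, h2, one_mul]

/-- Each column of `twistedShift` has a single nonzero entry. -/
theorem exists_twistedShift_col {n : ℕ} [NeZero (2 * n)] (g : ZMod (2 * n)) (b : Fin n) :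
    ∃ e s, (s = 1 ∨ s = -1) ∧ (∀ a, twistedShift n (-1) g a b = if a = e then s else 0) ∧
      ∀ a, twistedShift n 1 g a b = if a = e then 1 else 0 := by
  have hsum := sum_twistedShift_one_col g b
  have hrel : ∀ a, (twistedShift n 1 g a b = 0 ∧ twistedShift n (-1) g a b = 0) ∨
      (1 ≤ twistedShift n 1 g a b ∧ (twistedShift n 1 g a b = 1 →
        twistedShift n (-1) g a b = 1 ∨ twistedShift n (-1) g a b = -1)) := by
    intro a
    simp only [twistedShift, Matrix.of_apply]
    split_ifs <;> simp
  have hnonneg : ∀ a, 0 ≤ twistedShift n 1 g a b := fun a => by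
    rcases hrel a with h | h <;> omega
  obtain ⟨e, -, he⟩ : ∃ e ∈ Finset.univ, twistedShift n 1 g e b ≠ 0 :=
    Finset.exists_ne_zero_of_sum_ne_zero (by rw [hsum]; exact one_ne_zero)
  have hsplit := Finset.add_sum_erase Finset.univ (fun a => twistedShift n 1 g a b)
    (Finset.mem_univ e)
  have hrest : 0 ≤ ∑ a ∈ Finset.univ.erase e, twistedShift n 1 g a b :=
    Finset.sum_nonneg fun a _ => hnonneg a
  simp only [hsum] at hsplit
  have he1 : twistedShift n 1 g e b = 1 := by
    rcases hrel e with h | h <;> omega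
  have hzero : ∀ a, a ≠ e → twistedShift n 1 g a b = 0 := fun a ha =>
    (Finset.sum_eq_zero_iff_of_nonneg fun a _ => hnonneg a).mp (by omega) a
      (Finset.mem_erase.mpr ⟨ha, Finset.mem_univ a⟩)
  refine ⟨e, twistedShift n (-1) g e b, ?_, fun a => ?_, fun a => ?_⟩
  · rcases hrel e with h | h
    · omega
    · exact h.2 he1
  · split_ifs with h
    · rw [h]
    · rcases hrel a with h' | h'
      · exact h'.2
      · have := hzero a h
        omega
  · split_ifs with h
    · rw [h, he1]
    · exact hzero a h

/-- The block matrix with zero diagonal blocks and off-diagonal blocks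
`M * twistedShift n u (c i j)`. -/
def shiftBlock {m n : ℕ} (u : ℤ) (c : Fin m → Fin m → ZMod (2 * n))
    (M : Matrix (Fin n) (Fin n) ℤ) : Matrix (Fin m × Fin n) (Fin m × Fin n) ℤ :=
  Matrix.of fun x y => if x.1 = y.1 then 0 else (M * twistedShift n u (c x.1 y.1)) x.2 y.2

theorem shiftBlock_mul_transpose_apply {m n : ℕ} [NeZero (2 * n)] {u : ℤ} (hu : u * u = 1)
    (c : Fin m → Fin m → ZMod (2 * n)) (M : Matrix (Fin n) (Fin n) ℤ) (x y : Fin m × Fin n) :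
    (shiftBlock u c M * (shiftBlock u c M)ᵀ) x y =
      (M * (∑ ℓ with ℓ ≠ x.1 ∧ ℓ ≠ y.1, twistedShift n u (c x.1 ℓ - c y.1 ℓ)) * Mᵀ) x.2 y.2 := by
  rw [Matrix.mul_sum, Matrix.sum_mul, Matrix.sum_apply, Finset.sum_filter, Matrix.mul_apply,
    Fintype.sum_prod_type]
  refine Finset.sum_congr rfl fun ℓ _ => ?_
  by_cases h1 : x.1 = ℓ
  · simp [shiftBlock, h1]
  by_cases h2 : y.1 = ℓ
  · simp [shiftBlock, h2]
  rw [if_pos ⟨Ne.symm h1, Ne.symm h2⟩, ← twistedShift_mul_transpose hu,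
    ← Matrix.mul_assoc, Matrix.mul_assoc (M * _), ← Matrix.transpose_mul, Matrix.mul_apply]
  simp [shiftBlock, h1, h2]

theorem shiftBlock_mul_transpose {m n : ℕ} [NeZero (2 * n)] {u : ℤ} (hu : u * u = 1)
    {c : Fin (m + 1) → Fin (m + 1) → ZMod (2 * n)} {t : ℕ}
    (hc : ∀ i j : Fin (m + 1), i ≠ j → ∀ g : ZMod (2 * n),
      (Finset.univ.filter fun ℓ => ℓ ≠ i ∧ ℓ ≠ j ∧ c i ℓ - c j ℓ = g).card = t)
    (M : Matrix (Fin n) (Fin n) ℤ) (x y : Fin (m + 1) × Fin n) :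
    (shiftBlock u c M * (shiftBlock u c M)ᵀ) x y =
      if x.1 = y.1 then m * (M * Mᵀ) x.2 y.2
      else t * (1 + u) * (M * allOnes (Fin n) * Mᵀ) x.2 y.2 := by
  rw [shiftBlock_mul_transpose_apply hu]
  split_ifs with h
  · have hcard : (Finset.univ.filter fun ℓ => ℓ ≠ y.1).card = m := by
      rw [Finset.filter_ne', Finset.card_erase_of_mem (Finset.mem_univ _)]
      simp
    rw [h]
    simp only [sub_self, twistedShift_zero, and_self, Finset.sum_const, hcard]
    rw [Matrix.mul_smul, Matrix.smul_mul, Matrix.mul_one, Matrix.smul_apply, nsmul_eq_mul]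
  · have hsum : (∑ ℓ with ℓ ≠ x.1 ∧ ℓ ≠ y.1, twistedShift n u (c x.1 ℓ - c y.1 ℓ)) =
        (t * (1 + u)) • allOnes (Fin n) := by
      rw [← Finset.sum_fiberwise _ fun ℓ => c x.1 ℓ - c y.1 ℓ, mul_smul, ← sum_twistedShift,
        Finset.smul_sum]
      refine Finset.sum_congr rfl fun g _ => ?_
      rw [Finset.sum_congr rfl fun ℓ hℓ => by rw [(Finset.mem_filter.mp hℓ).2],
        Finset.sum_const, Finset.filter_filter]
      simp only [and_assoc]
      rw [hc x.1 y.1 h g, natCast_zsmul]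
    rw [hsum, Matrix.mul_smul, Matrix.smul_mul, Matrix.smul_apply, smul_eq_mul]

theorem shiftBlock_mul_blockJ {m n : ℕ} [NeZero (2 * n)]
    (c : Fin m → Fin m → ZMod (2 * n)) {M : Matrix (Fin n) (Fin n) ℤ} {k : ℤ}
    (hM : ∀ a, ∑ b, M a b = k) :
    shiftBlock 1 c M * blockJ m n = k • (allOnes (Fin m × Fin n) - blockJ m n) := by
  ext ⟨i, a⟩ ⟨j, b⟩
  rw [Matrix.mul_apply, Fintype.sum_prod_type]
  have hrow : ∀ g, ∑ b, (M * twistedShift n 1 g) a b = k := by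
    intro g
    simp only [Matrix.mul_apply]
    rw [Finset.sum_comm]
    simp only [← Finset.mul_sum, sum_twistedShift_one_row, mul_one, hM]
  by_cases h : i = j
  · subst h
    simp only [shiftBlock, blockJ, allOnes, Matrix.of_apply, Matrix.smul_apply, Matrix.sub_apply]
    simp
  · simp [shiftBlock, blockJ, allOnes, h, hrow]

theorem blockJ_mul_shiftBlock {m n : ℕ} [NeZero (2 * n)]
    (c : Fin m → Fin m → ZMod (2 * n)) {M : Matrix (Fin n) (Fin n) ℤ} {k : ℤ}
    (hM : ∀ b, ∑ a, M a b = k) :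
    blockJ m n * shiftBlock 1 c M = k • (allOnes (Fin m × Fin n) - blockJ m n) := by
  ext ⟨i, a⟩ ⟨j, b⟩
  rw [Matrix.mul_apply, Fintype.sum_prod_type]
  have hcol : ∀ g, ∑ a, (M * twistedShift n 1 g) a b = k := by
    intro g
    simp only [Matrix.mul_apply]
    rw [Finset.sum_comm]
    simp only [← Finset.sum_mul, hM, ← Finset.mul_sum, sum_twistedShift_one_col, mul_one]
  rw [Finset.sum_eq_single i (fun ℓ _ hℓ => by simp [blockJ, hℓ.symm]) (by simp)]
  by_cases h : i = j <;> simp [shiftBlock, blockJ, allOnes, h, hcol]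

/-- Multiplying by a signed permutation matrix permutes the columns up to sign. -/
theorem exists_mul_twistedShift_apply {n : ℕ} [NeZero (2 * n)] (g : ZMod (2 * n)) (b : Fin n) :
    ∃ e s, (s = 1 ∨ s = -1) ∧ ∀ M : Matrix (Fin n) (Fin n) ℤ, ∀ a,
      (M * twistedShift n (-1) g) a b = M a e * s ∧ (M * twistedShift n 1 g) a b = M a e := by
  obtain ⟨e, s, hs, h1, h2⟩ := exists_twistedShift_col g b
  exact ⟨e, s, hs, fun M a => by simp [Matrix.mul_apply, h1, h2]⟩

theorem shiftBlock_map_abs {m n : ℕ} [NeZero (2 * n)] (c : Fin m → Fin m → ZMod (2 * n))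
    (M : Matrix (Fin n) (Fin n) ℤ) :
    (shiftBlock (-1) c M).map (fun t => |t|) = shiftBlock 1 c (M.map fun t => |t|) := by
  ext x y
  by_cases h : x.1 = y.1
  · simp [shiftBlock, h]
  · obtain ⟨e, s, hs, hM⟩ := exists_mul_twistedShift_apply (c x.1 y.1) y.2
    rcases hs with rfl | rfl <;> simp [shiftBlock, h, hM]

theorem shiftBlock_apply_mem {m n : ℕ} [NeZero (2 * n)] (c : Fin m → Fin m → ZMod (2 * n))
    {M : Matrix (Fin n) (Fin n) ℤ} (hM : ∀ i j, M i j = -1 ∨ M i j = 0 ∨ M i j = 1)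
    (x y : Fin m × Fin n) :
    shiftBlock (-1) c M x y = -1 ∨ shiftBlock (-1) c M x y = 0 ∨ shiftBlock (-1) c M x y = 1 := by
  by_cases h : x.1 = y.1
  · simp [shiftBlock, h]
  · obtain ⟨e, s, hs, hMs⟩ := exists_mul_twistedShift_apply (c x.1 y.1) y.2
    have hv : shiftBlock (-1) c M x y = M x.2 e * s := by simp [shiftBlock, h, hMs]
    rw [hv]
    rcases hs with rfl | rfl <;> rcases hM x.2 e with h | h | h <;> simp [h]

/-- If `M * Mᵀ` is a nonzero multiple of the identity, then so is `Mᵀ * M`. -/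
theorem transpose_mul_of_mul_transpose {ι : Type*} [Fintype ι] [DecidableEq ι]
    {M : Matrix ι ι ℤ} {k : ℤ} (h : M * Mᵀ = k • 1) : Mᵀ * M = k • 1 := by
  rw [← h]
  apply transpose_mul_self_eq_of_commute
  rw [h]
  exact (Commute.one_right M).smul_right k

theorem sum_abs_of_mul_transpose_diag {n : ℕ} {M : Matrix (Fin n) (Fin n) ℤ} {k : ℤ}
    (hM : ∀ i j, M i j = -1 ∨ M i j = 0 ∨ M i j = 1) (h : M * Mᵀ = k • 1) (a : Fin n) :
    ∑ b, |M a b| = k := by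
  have := congrFun (congrFun h a) a
  rw [Matrix.mul_apply] at this
  simp only [Matrix.transpose_apply, Matrix.smul_apply, Matrix.one_apply_eq, smul_eq_mul,
    mul_one] at this
  rw [← this]
  refine Finset.sum_congr rfl fun b _ => ?_
  rcases hM a b with h | h | h <;> simp [h]

theorem stmt6 (m n k lam : ℕ) (hm : 0 < m) (hn : 0 < n) (hk : 0 < k) (hlam : 0 < lam)
    (hdvd : 2 * n ∣ m - 1)
    -- a BGW(m+1, m, m-1) over the cyclic group ℤ/2nℤ
    (c : Fin (m + 1) → Fin (m + 1) → ZMod (2 * n))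
    (hc : ∀ i j : Fin (m + 1), i ≠ j → ∀ g : ZMod (2 * n),
      (Finset.univ.filter fun ℓ => ℓ ≠ i ∧ ℓ ≠ j ∧ c i ℓ - c j ℓ = g).card =
        (m - 1) / (2 * n))
    -- a BGW(n, k, λ) over {1, -1}
    (C : Matrix (Fin n) (Fin n) ℤ)
    (hC01 : ∀ i j, C i j = -1 ∨ C i j = 0 ∨ C i j = 1)
    (hCW : C * Cᵀ = (k : ℤ) • 1)
    (hCB : (C.map fun t => |t|) * (C.map fun t => |t|)ᵀ =
      ((k : ℤ) - (lam : ℤ)) • 1 + (lam : ℤ) • allOnes (Fin n)) :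
    ∃ W : Matrix (Fin (m + 1) × Fin n) (Fin (m + 1) × Fin n) ℤ,
      (∀ x y, W x y = -1 ∨ W x y = 0 ∨ W x y = 1) ∧
      W * Wᵀ = ((m : ℤ) * k) • 1 ∧
      (W.map fun t => |t|) * (W.map fun t => |t|)ᵀ =
        ((m : ℤ) * k) • 1 + ((m : ℤ) * lam) • (blockJ (m + 1) n - 1) +
          ((((m - 1) / n : ℕ) : ℤ) * (k : ℤ) ^ 2) •
            (allOnes (Fin (m + 1) × Fin n) - blockJ (m + 1) n) ∧
      (W.map fun t => |t|)ᵀ * (W.map fun t => |t|) =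
        ((m : ℤ) * k) • 1 + ((m : ℤ) * lam) • (blockJ (m + 1) n - 1) +
          ((((m - 1) / n : ℕ) : ℤ) * (k : ℤ) ^ 2) •
            (allOnes (Fin (m + 1) × Fin n) - blockJ (m + 1) n) ∧
      (W.map fun t => |t|) * blockJ (m + 1) n =
        (k : ℤ) • (allOnes (Fin (m + 1) × Fin n) - blockJ (m + 1) n) ∧
      blockJ (m + 1) n * (W.map fun t => |t|) =
        (k : ℤ) • (allOnes (Fin (m + 1) × Fin n) - blockJ (m + 1) n) := by
  have : NeZero (2 * n) := ⟨by omega⟩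
  set B : Matrix (Fin n) (Fin n) ℤ := C.map fun t => |t| with hB
  have hrow : ∀ a, ∑ b, B a b = k := sum_abs_of_mul_transpose_diag hC01 hCW
  have hcol : ∀ b, ∑ a, B a b = k :=
    sum_abs_of_mul_transpose_diag (M := Cᵀ) (fun i j => hC01 j i)
      (by rw [Matrix.transpose_transpose, transpose_mul_of_mul_transpose hCW])
  have hdiv : (((m - 1) / n : ℕ) : ℤ) = ((m - 1) / (2 * n) : ℕ) * (1 + 1) := by
    obtain ⟨t, ht⟩ := hdvd
    rw [ht, Nat.mul_div_cancel_left t (by omega), mul_comm 2 n, mul_assoc,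
      Nat.mul_div_cancel_left _ hn]
    push_cast
    ring
  have hBJ : B * allOnes (Fin n) * Bᵀ = (k : ℤ) ^ 2 • allOnes (Fin n) := by
    ext a b
    simp [Matrix.mul_apply, allOnes, hrow, ← Finset.mul_sum, sq]
  have hright := shiftBlock_mul_blockJ c hrow
  have hleft := blockJ_mul_shiftBlock c hcol
  have hgram : shiftBlock 1 c B * (shiftBlock 1 c B)ᵀ =
      ((m : ℤ) * k) • 1 + ((m : ℤ) * lam) • (blockJ (m + 1) n - 1) +
          ((((m - 1) / n : ℕ) : ℤ) * (k : ℤ) ^ 2) •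
            (allOnes (Fin (m + 1) × Fin n) - blockJ (m + 1) n) := by
    ext ⟨i, a⟩ ⟨j, b⟩
    rw [shiftBlock_mul_transpose (one_mul 1) hc, hCB, hBJ, hdiv]
    by_cases h : i = j <;> by_cases h' : a = b <;>
      simp only [blockJ, allOnes, Matrix.add_apply, Matrix.sub_apply, Matrix.smul_apply,
        Matrix.one_apply, Matrix.of_apply, Prod.mk.injEq, smul_eq_mul, h, h', if_true, if_false,
        and_true, and_false] <;> ring
  have hcommJ : Commute (shiftBlock 1 c B) (blockJ (m + 1) n) := hright.trans hleft.symm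
  have hcommO : Commute (shiftBlock 1 c B)
      (allOnes (Fin (m + 1) × Fin n) - blockJ (m + 1) n) := by
    have h := (Commute.refl (shiftBlock 1 c B)).mul_right hcommJ
    rw [hright] at h
    have hk' : (k : ℤ) ≠ 0 := by exact_mod_cast hk.ne'
    refine smul_right_injective _ hk' ?_
    simpa only [Matrix.mul_smul, Matrix.smul_mul] using h.eq
  have hcomm : Commute (shiftBlock 1 c B) (shiftBlock 1 c B * (shiftBlock 1 c B)ᵀ) := by
    rw [hgram]
    exact (((Commute.one_right _).smul_right _).add_right
      ((hcommJ.sub_right (Commute.one_right _)).smul_right _)).add_right (hcommO.smul_right _)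
  refine ⟨shiftBlock (-1) c C, shiftBlock_apply_mem c hC01, ?_, ?_⟩
  · ext ⟨i, a⟩ ⟨j, b⟩
    rw [shiftBlock_mul_transpose (by norm_num) hc, hCW]
    by_cases h : i = j <;> by_cases h' : a = b <;> simp [h, h']
  · rw [shiftBlock_map_abs]
    exact ⟨hgram, (transpose_mul_self_eq_of_commute hcomm).trans hgram, hright, hleft⟩
end

section
/- Let m, n, k, λ be positive integers with 2n ∣ m − 1. Suppose there exist (i) a BGW(m+1,m,m−1) over the cyclic group ℤ/2nℤ, encoded as a function c defined on ordered pairs of distinct elements of {0,1,…,m} with values in ℤ/2nℤ such that for all distinct i, j and every g ∈ ℤ/2nℤ, the number of indices ℓ ∉ {i,j} with c(i,ℓ) − c(j,ℓ) = g equals (m−1)/(2n); and (ii) a BGW(n,k,λ) over {1,−1} given by a matrix C that is negacirculant, i.e. C commutes with the n×n nega-shift matrix N (where N_{i,i+1} = 1 for 1 ≤ i ≤ n−1, N_{n,1} = −1, and all other entries are 0). Then there exists an ((m+1)n)×((m+1)n) integer matrix W, with rows and columns indexed by {0,…,m}×{1,…,n}, whose entries lie in {−1,0,1}, such that W·Wᵀ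 = mk·I, the matrix |W| is symmetric with zero diagonal, |W|² = mk·I + mλ·(𝒥_{m+1,n} − I) + ((m−1)/n)k²·(J − 𝒥_{m+1,n}) (so |W| is the adjacency matrix of a divisible design graph DDG((m+1)n, mk, m+1, n, mλ, ((m−1)/n)k²)), and |W|·𝒥_{m+1,n} = 𝒥_{m+1,n}·|W| = k·(J − 𝒥_{m+1,n}). -/
open Matrix

/-- The `n × n` nega-shift matrix: `N_{i,i+1} = 1`, `N_{n-1,0} = -1` (0-indexed),
all other entries `0`. -/
def negaShift (n : ℕ) : Matrix (Fin n) (Fin n) ℤ :=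
  Matrix.of fun i j =>
    if (i : ℕ) + 1 = (j : ℕ) then 1
    else if (i : ℕ) = n - 1 ∧ (j : ℕ) = 0 then -1 else 0

theorem ZMod.sum_eq_sum_range {M : Type*} [AddCommMonoid M] (N : ℕ) [NeZero N] (F : ZMod N → M) :
    ∑ x, F x = ∑ i ∈ Finset.range N, F i := by
  refine Finset.sum_nbij' (fun x => x.val) (fun i => (i : ZMod N)) ?_ ?_ ?_ ?_ ?_
  · intro x _
    simpa using ZMod.val_lt x
  · simp
  · simp
  · intro i hi
    exact ZMod.val_cast_of_lt (Finset.mem_range.1 hi)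
  · simp

/-- A function on `ZMod (2 * n)` with period `n` has, over any shift of `{0, …, n - 1}`,
half of its total sum. -/
theorem two_mul_sum_fin_of_periodic {n : ℕ} [NeZero (2 * n)] {F : ZMod (2 * n) → ℤ}
    (hF : ∀ x, F (x + n) = F x) (s : ZMod (2 * n)) :
    2 * ∑ b : Fin n, F (s + ((b : ℕ) : ZMod (2 * n))) = ∑ x, F x := by
  rw [← Equiv.sum_comp (Equiv.addLeft s) F, ZMod.sum_eq_sum_range, two_mul,
    show Finset.range (2 * n) = Finset.range (n + n) by rw [two_mul], Finset.sum_range_add, Fin.sum_univ_eq_sum_range (fun b => F (s + (b : ZMod (2 * n))))]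
  congr 1
  refine Finset.sum_congr rfl fun b _ => ?_
  rw [← hF]
  simp only [Equiv.coe_addLeft]
  push_cast
  congr 1
  ring

/-- The negaperiodic extension to `ZMod (2 * n)` of the first row of a matrix. -/
def negaRow {n : ℕ} (hn : 0 < n) (C : Matrix (Fin n) (Fin n) ℤ) (x : ZMod (2 * n)) : ℤ :=
  if x.val < n then C ⟨0, hn⟩ ⟨x.val % n, Nat.mod_lt _ hn⟩
  else -C ⟨0, hn⟩ ⟨x.val % n, Nat.mod_lt _ hn⟩

theorem negaRow_natCast {n : ℕ} (hn : 0 < n) (C : Matrix (Fin n) (Fin n) ℤ) (b : Fin n) :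
    negaRow hn C ((b : ℕ) : ZMod (2 * n)) = C ⟨0, hn⟩ b := by
  have hb := b.2
  have hv : ((b : ℕ) : ZMod (2 * n)).val = b := ZMod.val_cast_of_lt (by omega)
  simp [negaRow, hv, Nat.mod_eq_of_lt hb]

theorem negaRow_add {n : ℕ} (hn : 0 < n) (C : Matrix (Fin n) (Fin n) ℤ) (x : ZMod (2 * n)) :
    negaRow hn C (x + n) = -negaRow hn C x := by
  have : NeZero (2 * n) := ⟨by omega⟩
  have hx := ZMod.val_lt x
  have hnv : (n : ZMod (2 * n)).val = n := ZMod.val_cast_of_lt (by omega)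
  by_cases h : x.val < n
  · have hv : (x + n).val = x.val + n := by
      rw [ZMod.val_add_of_lt] <;> omega
    simp [negaRow, hv, h]
  · have hv : (x + n).val = x.val - n := by
      have := ZMod.val_add_val_of_le (a := x) (b := (n : ZMod (2 * n))) (by omega)
      omega
    have hlt : x.val - n < n := by omega
    have hmod : (x.val - n) % n = x.val % n := (Nat.mod_eq_sub_mod (by omega)).symm
    simp [negaRow, hv, h, hlt, hmod]

theorem negaShift_mul_apply_of_succ {n : ℕ} (C : Matrix (Fin n) (Fin n) ℤ) {a a' : Fin n}
    (h : (a : ℕ) + 1 = a') (b : Fin n) : (negaShift n * C) a b = C a' b := by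
  rw [Matrix.mul_apply, Finset.sum_eq_single a']
  · simp [negaShift, h]
  · intro j _ hj
    have h1 : (a : ℕ) + 1 ≠ j := fun e => hj (Fin.ext (by omega))
    have h2 : (a : ℕ) ≠ n - 1 := by have := a'.2; omega
    simp [negaShift, h1, h2]
  · simp

theorem mul_negaShift_apply_of_succ {n : ℕ} (C : Matrix (Fin n) (Fin n) ℤ) {b b' : Fin n}
    (h : (b' : ℕ) + 1 = b) (a : Fin n) : (C * negaShift n) a b = C a b' := by
  rw [Matrix.mul_apply, Finset.sum_eq_single b']
  · simp [negaShift, h]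
  · intro j _ hj
    have h1 : (j : ℕ) + 1 ≠ b := fun e => hj (Fin.ext (by omega))
    have h2 : (b : ℕ) ≠ 0 := by omega
    simp [negaShift, h1, h2]
  · simp

theorem mul_negaShift_apply_zero {n : ℕ} (hn : 0 < n) (C : Matrix (Fin n) (Fin n) ℤ) (a : Fin n) :
    (C * negaShift n) a ⟨0, hn⟩ = -C a ⟨n - 1, by omega⟩ := by
  rw [Matrix.mul_apply, Finset.sum_eq_single ⟨n - 1, by omega⟩]
  · simp [negaShift]
  · intro j _ hj
    have h1 : (j : ℕ) ≠ n - 1 := fun e => hj (Fin.ext e)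
    simp [negaShift, h1]
  · simp

/-- A matrix commuting with the nega-shift is determined by its first row. -/
theorem eq_negaRow_of_commute {n : ℕ} (hn : 0 < n) {C : Matrix (Fin n) (Fin n) ℤ}
    (hC : C * negaShift n = negaShift n * C) (a b : Fin n) :
    C a b = negaRow hn C (((b : ℕ) : ZMod (2 * n)) - ((a : ℕ) : ZMod (2 * n))) := by
  obtain ⟨a, ha⟩ := a
  induction a generalizing b with
  | zero => simp [negaRow_natCast]
  | succ a ih =>
    have ha' : a < n := by omega
    rw [← negaShift_mul_apply_of_succ C (a := ⟨a, ha'⟩) (a' := ⟨a + 1, ha⟩) rfl, ← hC]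
    obtain ⟨b, hb⟩ := b
    cases b with
    | zero =>
      rw [mul_negaShift_apply_zero hn, ih _ ha', ← negaRow_add]
      congr 1
      have h2 : ((2 * n : ℕ) : ZMod (2 * n)) = 0 := ZMod.natCast_self _
      push_cast [Nat.cast_sub (show 1 ≤ n from hn)] at h2 ⊢
      linear_combination h2
    | succ b =>
      rw [mul_negaShift_apply_of_succ C (b := ⟨b + 1, hb⟩) (b' := ⟨b, by omega⟩) rfl, ih _ ha']
      congr 1
      push_cast
      ring

/-- The differences of two distinct rows of a generalized conference matrix are equidistributed. -/
theorem sum_comp_sub_of_card_fiber {ι G M : Type*} [Fintype ι] [DecidableEq ι] [AddGroup G]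
    [Fintype G] [DecidableEq G] [AddCommMonoid M] {c : ι → ι → G} {μ : ℕ} {i j : ι}
    (h : ∀ g, (Finset.univ.filter fun l => l ≠ i ∧ l ≠ j ∧ c i l - c j l = g).card = μ)
    (H : G → M) :
    ∑ l with l ≠ i ∧ l ≠ j, H (c i l - c j l) = μ • ∑ g, H g := by
  rw [← Finset.sum_fiberwise _ (fun l => c i l - c j l), Finset.smul_sum]
  refine Finset.sum_congr rfl fun g _ => ?_
  rw [← h g, ← Finset.sum_const, Finset.filter_filter]
  simp only [and_assoc]
  refine Finset.sum_congr rfl fun l hl => ?_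
  rw [(Finset.mem_filter.1 hl).2.2.2]

theorem two_nsmul_sum_univ {G : Type*} [AddCommGroup G] [Fintype G] : 2 • ∑ g : G, g = 0 := by
  have h : ∑ g : G, -g = ∑ g : G, g := Equiv.sum_comp (Equiv.neg G) id
  rw [Finset.sum_neg_distrib] at h
  rw [two_nsmul]
  nth_rewrite 1 [← h]
  simp

theorem ZMod.eq_zero_or_eq_of_two_nsmul_eq_zero {n : ℕ} (hn : 0 < n) {x : ZMod (2 * n)}
    (hx : 2 • x = 0) : x = 0 ∨ x = n := by
  have : NeZero (2 * n) := ⟨by omega⟩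
  have hlt := ZMod.val_lt x
  rw [← ZMod.natCast_zmod_val x] at hx ⊢
  have h : ((2 * x.val : ℕ) : ZMod (2 * n)) = 0 := by
    rw [← hx]
    push_cast
    simp [two_mul]
  rw [ZMod.natCast_eq_zero_iff] at h
  obtain ⟨t, ht⟩ := Nat.dvd_of_mul_dvd_mul_left two_pos h
  have ht2 : t < 2 := by
    by_contra! h2
    nlinarith
  interval_cases t
  · left
    simp [ht]
  · right
    simp [ht]

/-- The generalized conference matrix `c` normalized by its row sums. -/
def normalizedRow {ι G : Type*} [Fintype ι] [DecidableEq ι] [AddCommGroup G] (c : ι → ι → G)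
    (i j : ι) : G :=
  c i j - ∑ l with l ≠ i, c i l

theorem two_nsmul_normalizedRow_sub {ι G : Type*} [Fintype ι] [DecidableEq ι] [AddCommGroup G]
    [Fintype G] [DecidableEq G] {c : ι → ι → G} {μ : ℕ} {i j : ι} (hij : i ≠ j)
    (h : ∀ g, (Finset.univ.filter fun l => l ≠ i ∧ l ≠ j ∧ c i l - c j l = g).card = μ) :
    2 • (normalizedRow c j i - normalizedRow c i j) = 0 := by
  have key : normalizedRow c j i - normalizedRow c i j = μ • ∑ g : G, g := by
    rw [← sum_comp_sub_of_card_fiber h (fun g => g), Finset.sum_sub_distrib]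
    have hi : ∑ l with l ≠ i, c i l = c i j + ∑ l with l ≠ i ∧ l ≠ j, c i l := by
      rw [← Finset.filter_filter, Finset.filter_ne' _ j, Finset.add_sum_erase]
      simpa using hij.symm
    have hj : ∑ l with l ≠ j, c j l = c j i + ∑ l with l ≠ i ∧ l ≠ j, c j l := by
      simp only [and_comm (a := _ ≠ i)]
      rw [← Finset.filter_filter, Finset.filter_ne' _ i, Finset.add_sum_erase]
      simpa using hij
    rw [normalizedRow, normalizedRow, hi, hj]
    abel
  rw [key, smul_comm, two_nsmul_sum_univ, smul_zero]

/-- The block matrix with zero diagonal blocks whose block `(i, j)` is the back-circulant matrix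
of `φ` shifted by `d i j`. -/
def backCirculantBlocks {ι : Type*} [DecidableEq ι] {n : ℕ} (d : ι → ι → ZMod (2 * n))
    (φ : ZMod (2 * n) → ℤ) : Matrix (ι × Fin n) (ι × Fin n) ℤ :=
  Matrix.of fun x y =>
    if x.1 = y.1 then 0
    else φ (d x.1 y.1 + ((x.2 : ℕ) : ZMod (2 * n)) + ((y.2 : ℕ) : ZMod (2 * n)))

theorem backCirculantBlocks_mul_transpose_of_eq {ι : Type*} [Fintype ι] [DecidableEq ι] {n : ℕ}
    [NeZero (2 * n)] {φ : ZMod (2 * n) → ℤ} (hφ : ∀ x y, φ (x + n) * φ (y + n) = φ x * φ y)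
    {D : Matrix (Fin n) (Fin n) ℤ}
    (hD : ∀ a b, D a b = φ (((b : ℕ) : ZMod (2 * n)) - ((a : ℕ) : ZMod (2 * n))))
    (d : ι → ι → ZMod (2 * n)) (i : ι) (a a' : Fin n) :
    (backCirculantBlocks d φ * (backCirculantBlocks d φ)ᵀ) (i, a) (i, a') =
      ((Fintype.card ι - 1 : ℕ) : ℤ) * (D * Dᵀ) a' a := by
  have hper (t : ZMod (2 * n)) (x : ZMod (2 * n)) :
      φ (x + n) * φ (x + n + t) = φ x * φ (x + t) := by
    rw [add_right_comm, hφ]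
  have hDD : 2 * (D * Dᵀ) a' a =
      ∑ x, φ x * φ (x + (((a' : ℕ) : ZMod (2 * n)) - ((a : ℕ) : ZMod (2 * n)))) := by
    rw [← two_mul_sum_fin_of_periodic (hper _) (-((a' : ℕ) : ZMod (2 * n)))]
    simp only [Matrix.mul_apply, Matrix.transpose_apply, hD]
    congr 1
    refine Finset.sum_congr rfl fun b _ => ?_
    congr 2 <;> ring
  have hrow (l : ι) : ∑ b : Fin n, backCirculantBlocks d φ (i, a) (l, b) *
      backCirculantBlocks d φ (i, a') (l, b) = if l = i then 0 else (D * Dᵀ) a' a := by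
    by_cases hl : i = l
    · simp [backCirculantBlocks, hl]
    · rw [if_neg (Ne.symm hl)]
      refine mul_left_cancel₀ (two_ne_zero (α := ℤ)) ?_
      rw [hDD, ← two_mul_sum_fin_of_periodic (hper _) (d i l + ((a : ℕ) : ZMod (2 * n)))]
      congr 1
      refine Finset.sum_congr rfl fun b _ => ?_
      simp only [backCirculantBlocks, Matrix.of_apply, if_neg hl]
      congr 2
      ring
  rw [Matrix.mul_apply, Fintype.sum_prod_type]
  simp only [Matrix.transpose_apply, hrow]
  rw [← Finset.add_sum_erase _ _ (Finset.mem_univ i), if_pos rfl, zero_add,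
    Finset.sum_congr rfl fun l hl => if_neg (Finset.ne_of_mem_erase hl), Finset.sum_const,
    Finset.card_erase_of_mem (Finset.mem_univ i), Finset.card_univ, nsmul_eq_mul]

theorem backCirculantBlocks_mul_transpose_of_ne {ι : Type*} [Fintype ι] [DecidableEq ι] {n : ℕ}
    [NeZero (2 * n)] {φ : ZMod (2 * n) → ℤ} (hφ : ∀ x y, φ (x + n) * φ (y + n) = φ x * φ y)
    {c : ι → ι → ZMod (2 * n)} {μ : ℕ} {i j : ι}
    (h : ∀ g, (Finset.univ.filter fun l => l ≠ i ∧ l ≠ j ∧ c i l - c j l = g).card = μ)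
    (a a' : Fin n) :
    2 * (backCirculantBlocks (normalizedRow c) φ *
        (backCirculantBlocks (normalizedRow c) φ)ᵀ) (i, a) (j, a') = μ * (∑ x, φ x) ^ 2 := by
  set t : ZMod (2 * n) := ((a : ℕ) : ZMod (2 * n)) - ((a' : ℕ) : ZMod (2 * n)) -
    (∑ l with l ≠ i, c i l) + ∑ l with l ≠ j, c j l with ht
  have hper (t x : ZMod (2 * n)) : φ (x + n + t) * φ (x + n) = φ (x + t) * φ x := by
    rw [add_right_comm, hφ]
  have hrow (l : ι) : 2 * ∑ b : Fin n, backCirculantBlocks (normalizedRow c) φ (i, a) (l, b) *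
      backCirculantBlocks (normalizedRow c) φ (j, a') (l, b) =
      if l ≠ i ∧ l ≠ j then ∑ x, φ (x + (c i l - c j l + t)) * φ x else 0 := by
    by_cases hl : i = l
    · simp [backCirculantBlocks, hl]
    by_cases hl' : j = l
    · simp [backCirculantBlocks, hl']
    rw [if_pos ⟨Ne.symm hl, Ne.symm hl'⟩,
      ← two_mul_sum_fin_of_periodic (hper _) (normalizedRow c j l + ((a' : ℕ) : ZMod (2 * n)))]
    congr 1
    refine Finset.sum_congr rfl fun b _ => ?_
    simp only [backCirculantBlocks, Matrix.of_apply, if_neg hl, if_neg hl']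
    congr 2
    simp only [ht, normalizedRow]
    ring
  rw [Matrix.mul_apply, Fintype.sum_prod_type, Finset.mul_sum]
  simp only [Matrix.transpose_apply, hrow]
  rw [← Finset.sum_filter,
    sum_comp_sub_of_card_fiber h (fun g => ∑ x, φ (x + (g + t)) * φ x), Finset.sum_comm,
    nsmul_eq_mul, sq, Finset.mul_sum (f := φ)]
  congr 1
  refine Finset.sum_congr rfl fun x _ => ?_
  rw [← Finset.sum_mul]
  congr 1
  rw [← Equiv.sum_comp (Equiv.addRight (x + t)) φ]
  refine Finset.sum_congr rfl fun g _ => ?_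
  simp only [Equiv.coe_addRight]
  congr 1
  ring

theorem stmt7 (m n k lam : ℕ) (hm : 0 < m) (hn : 0 < n) (hk : 0 < k) (hlam : 0 < lam)
    (hdvd : 2 * n ∣ m - 1)
    -- a BGW(m+1, m, m-1) over the cyclic group ℤ/2nℤ
    (c : Fin (m + 1) → Fin (m + 1) → ZMod (2 * n))
    (hc : ∀ i j : Fin (m + 1), i ≠ j → ∀ g : ZMod (2 * n),
      (Finset.univ.filter fun ℓ => ℓ ≠ i ∧ ℓ ≠ j ∧ c i ℓ - c j ℓ = g).card =
        (m - 1) / (2 * n))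
    -- a negacirculant BGW(n, k, λ) over {1, -1}
    (C : Matrix (Fin n) (Fin n) ℤ)
    (hC01 : ∀ i j, C i j = -1 ∨ C i j = 0 ∨ C i j = 1)
    (hCW : C * Cᵀ = (k : ℤ) • 1)
    (hCB : (C.map fun t => |t|) * (C.map fun t => |t|)ᵀ =
      ((k : ℤ) - (lam : ℤ)) • 1 + (lam : ℤ) • allOnes (Fin n))
    (hCneg : C * negaShift n = negaShift n * C) :
    ∃ W : Matrix (Fin (m + 1) × Fin n) (Fin (m + 1) × Fin n) ℤ,
      (∀ x y, W x y = -1 ∨ W x y = 0 ∨ W x y = 1) ∧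
      W * Wᵀ = ((m : ℤ) * k) • 1 ∧
      (W.map fun t => |t|).IsSymm ∧
      (∀ x, (W.map fun t => |t|) x x = 0) ∧
      (W.map fun t => |t|) * (W.map fun t => |t|) =
        ((m : ℤ) * k) • 1 + ((m : ℤ) * lam) • (blockJ (m + 1) n - 1) +
          ((((m - 1) / n : ℕ) : ℤ) * (k : ℤ) ^ 2) •
            (allOnes (Fin (m + 1) × Fin n) - blockJ (m + 1) n) ∧
      (W.map fun t => |t|) * blockJ (m + 1) n =
        (k : ℤ) • (allOnes (Fin (m + 1) × Fin n) - blockJ (m + 1) n) ∧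
      blockJ (m + 1) n * (W.map fun t => |t|) =
        (k : ℤ) • (allOnes (Fin (m + 1) × Fin n) - blockJ (m + 1) n) := by
  have : NeZero (2 * n) := ⟨by omega⟩
  set γ := negaRow hn C with hγ
  set A : ZMod (2 * n) → ℤ := fun x => |γ x| with hA
  set d := normalizedRow c with hd
  have hodd (x) : γ (x + n) = -γ x := negaRow_add hn C x
  have hAper (x) : A (x + n) = A x := by simp [hA, hodd]
  have hγ2 (x y) : γ (x + n) * γ (y + n) = γ x * γ y := by simp [hodd]
  have hA2 (x y) : A (x + n) * A (y + n) = A x * A y := by simp [hAper]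
  have hCγ := eq_negaRow_of_commute hn hCneg
  have hγ01 (x) : γ x = -1 ∨ γ x = 0 ∨ γ x = 1 := by
    have := hC01 ⟨0, hn⟩ ⟨x.val % n, Nat.mod_lt _ hn⟩
    simp only [hγ, negaRow]
    split_ifs <;> omega
  have hγsum : ∑ x, γ x = 0 := by
    have h : ∑ x, γ (x + n) = ∑ x, γ x :=
      Equiv.sum_comp (Equiv.addRight (n : ZMod (2 * n))) γ
    simp only [hodd, Finset.sum_neg_distrib] at h
    omega
  have hAsum : ∑ x, A x = 2 * k := by
    have h := congrFun (congrFun hCW ⟨0, hn⟩) ⟨0, hn⟩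
    rw [← two_mul_sum_fin_of_periodic hAper 0, mul_right_inj' two_ne_zero]
    simp only [Matrix.mul_apply, Matrix.transpose_apply, Matrix.smul_apply, Matrix.one_apply_eq,
      smul_eq_mul, mul_one] at h
    rw [← h]
    refine Finset.sum_congr rfl fun b _ => ?_
    simp only [hA, zero_add, hγ, negaRow_natCast]
    rcases hC01 ⟨0, hn⟩ b with h | h | h <;> simp [h]
  have hAblock (s : ZMod (2 * n)) : ∑ b : Fin n, A (s + ((b : ℕ) : ZMod (2 * n))) = k := by
    have := two_mul_sum_fin_of_periodic hAper s
    omega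
  have hAsymm (i j) (hij : i ≠ j) (x : ZMod (2 * n)) : A (d j i + x) = A (d i j + x) := by
    have h := ZMod.eq_zero_or_eq_of_two_nsmul_eq_zero hn
      (two_nsmul_normalizedRow_sub hij (hc i j hij))
    rcases h with h | h <;> rw [sub_eq_iff_eq_add] at h <;> rw [hd, h]
    · rw [zero_add]
    · rw [← hAper (normalizedRow c i j + x)]
      congr 1
      ring
  have habs : (backCirculantBlocks d γ).map (fun t => |t|) = backCirculantBlocks d A := by
    ext x y
    simp only [backCirculantBlocks, Matrix.map_apply, Matrix.of_apply, hA]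
    split_ifs <;> simp
  have hsymm : (backCirculantBlocks d A).IsSymm := by
    ext ⟨i, a⟩ ⟨j, b⟩
    simp only [backCirculantBlocks, Matrix.transpose_apply, Matrix.of_apply, @eq_comm _ j i]
    split_ifs with h
    · rfl
    · rw [add_assoc, hAsymm i j h, add_assoc, add_comm ((b : ℕ) : ZMod (2 * n))]
  have hmulJ : backCirculantBlocks d A * blockJ (m + 1) n =
      (k : ℤ) • (allOnes (Fin (m + 1) × Fin n) - blockJ (m + 1) n) := by
    ext ⟨i, a⟩ ⟨j, b⟩
    rw [Matrix.mul_apply, Fintype.sum_prod_type, Finset.sum_eq_single j]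
    · by_cases hij : i = j
      · simp [backCirculantBlocks, blockJ, allOnes, hij]
      · simp [backCirculantBlocks, blockJ, allOnes, hij, hAblock]
    · intro l _ hl
      simp [blockJ, hl]
    · simp
  have hJsymm : (blockJ (m + 1) n)ᵀ = blockJ (m + 1) n := by
    ext x y
    simp [blockJ, eq_comm]
  have hOsymm : (allOnes (Fin (m + 1) × Fin n))ᵀ = allOnes (Fin (m + 1) × Fin n) := rfl
  refine ⟨backCirculantBlocks d γ, ?_, ?_, ?_, ?_, ?_, ?_, ?_⟩
  · intro x y
    simp only [backCirculantBlocks, Matrix.of_apply]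
    split_ifs
    · simp
    · exact hγ01 _
  · ext ⟨i, a⟩ ⟨j, b⟩
    by_cases hij : i = j
    · subst hij
      rw [backCirculantBlocks_mul_transpose_of_eq hγ2 hCγ, hCW]
      simp [Matrix.one_apply, eq_comm]
    · have h := backCirculantBlocks_mul_transpose_of_ne hγ2 (hc i j hij) a b
      rw [hγsum] at h
      simpa [Matrix.one_apply, hij] using h
  · rwa [habs]
  · intro x
    simp [backCirculantBlocks]
  · rw [habs]
    nth_rewrite 2 [← hsymm.eq]
    ext ⟨i, a⟩ ⟨j, b⟩
    by_cases hij : i = j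
    · subst hij
      rw [backCirculantBlocks_mul_transpose_of_eq (D := C.map fun t => |t|) hA2
        (fun a b => by simp [hA, hγ, hCγ a b]), hCB]
      simp only [Matrix.add_apply, Matrix.sub_apply, Matrix.smul_apply, Matrix.one_apply, blockJ,
        allOnes, Matrix.of_apply, Prod.mk.injEq, true_and, if_true, smul_eq_mul,
        Fintype.card_fin, Nat.add_sub_cancel, @eq_comm _ b a]
      split_ifs <;> ring
    · have h := backCirculantBlocks_mul_transpose_of_ne hA2 (hc i j hij) a b
      have hμ : (m - 1) / n = 2 * ((m - 1) / (2 * n)) := by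
        obtain ⟨t, ht⟩ := hdvd
        rw [ht, Nat.mul_div_cancel_left _ (by omega), mul_right_comm,
          Nat.mul_div_cancel _ hn]
      rw [hAsum] at h
      refine mul_left_cancel₀ (two_ne_zero (α := ℤ)) (h.trans ?_)
      simp only [Matrix.add_apply, Matrix.sub_apply, Matrix.smul_apply, Matrix.one_apply, blockJ,
        allOnes, Matrix.of_apply, hij, hμ, Prod.mk.injEq, false_and, if_false, smul_eq_mul]
      push_cast
      ring
  · rw [habs, hmulJ]
  · rw [habs]
    have h := congrArg Matrix.transpose hmulJ
    rwa [Matrix.transpose_mul, hsymm.eq, hJsymm, Matrix.transpose_smul, Matrix.transpose_sub,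
      hJsymm, hOsymm] at h
end
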